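/- (Dual form of the multilinear Hardy–Littlewood–Sobolev inequality.) Let m,n ≥ 1, 0 < α_k < n, α = Σ α_k with (m−1)n < α < mn, q = 2n/(mn−α), and p = q/(q−1). Then for every nonnegative measurable function g on ℝ^n, ∫_{(ℝ^n)^m} (∫_{ℝ^n} Π_{k=1}^m |y_k−x|^{−(n−α_k/2)} g(x) dx)² dy_1⋯dy_m ≤ G_α · (∫_{ℝ^n} g(x)^p dx)^{2/p}, where G_α = π^{mn/2 + n/q} · Π_{k=1}^m [Γ(α_k/4)² Γ((n−α_k)/2) / (Γ((2n−α_k)/4)² Γ(α_k/2))] · [Γ(n/p − n/2)/Γ(n/p)] · [Γ(n)/Γ(n/2)]^{2/p − 1}. -/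

import Mathlib

open MeasureTheory Real
open EuclideanGeometry (inversion)
open scoped ENNReal

noncomputable section

/-- Euclidean space of dimension `n`. -/
abbrev Euc (n : ℕ) := EuclideanSpace ℝ (Fin n)

lemma lintegral_rpow_mul_exp_neg_mul_Ioi {a r : ℝ} (ha : 0 < a) (hr : 0 < r) :
    ∫⁻ t in Set.Ioi (0 : ℝ), ENNReal.ofReal (t ^ (a - 1) * exp (-(r * t)))
      = ENNReal.ofReal (r ^ (-a) * Gamma a) := by
  have key := integral_rpow_mul_exp_neg_mul_Ioi ha hr
  have hpos : 0 < (1 / r) ^ a * Gamma a := mul_pos (by positivity) (Gamma_pos_of_pos ha)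
  rw [← ofReal_integral_eq_lintegral_ofReal, key, one_div, inv_rpow hr.le, rpow_neg hr.le]
  · exact .of_integral_ne_zero (by rw [key]; exact hpos.ne')
  · refine (ae_restrict_iff' measurableSet_Ioi).2 (.of_forall fun t (ht : 0 < t) => ?_)
    simp only [Pi.zero_apply]
    positivity

lemma lintegral_exp_neg_mul_sq_norm {n : ℕ} {b : ℝ} (hb : 0 < b) :
    ∫⁻ v : Euc n, ENNReal.ofReal (exp (-b * ‖v‖ ^ 2))
      = ENNReal.ofReal ((π / b) ^ ((n : ℝ) / 2)) := by
  have key := GaussianFourier.integral_rexp_neg_mul_sq_norm (V := Euc n) hb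
  rw [finrank_euclideanSpace_fin] at key
  rw [← ofReal_integral_eq_lintegral_ofReal, key]
  · exact .of_integral_ne_zero (by rw [key]; positivity)
  · exact .of_forall fun _ => (exp_pos _).le

lemma lintegral_exp_mul_exp {n : ℕ} {t s : ℝ} (ht : 0 < t) (hs : 0 < s) (x x' : Euc n) :
    ∫⁻ y : Euc n, ENNReal.ofReal (exp (-(t * ‖y - x‖ ^ 2)) * exp (-(s * ‖y - x'‖ ^ 2)))
      = ENNReal.ofReal ((π / (t + s)) ^ ((n : ℝ) / 2)
          * exp (-(t * s / (t + s) * ‖x - x'‖ ^ 2))) := by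
  have hts : 0 < t + s := by positivity
  set z : Euc n := (t / (t + s)) • x + (s / (t + s)) • x'
  have h (y : Euc n) : exp (-(t * ‖y - x‖ ^ 2)) * exp (-(s * ‖y - x'‖ ^ 2))
      = exp (-(t + s) * ‖y - z‖ ^ 2) * exp (-(t * s / (t + s) * ‖x - x'‖ ^ 2)) := by
    rw [← exp_add, ← exp_add]
    congr 1
    have hx : y - x = (y - z) - (s / (t + s)) • (x - x') := by
      have : x = (t / (t + s) + s / (t + s)) • x := by
        rw [← add_div, div_self hts.ne', one_smul]
      simp only [z]
      nth_rw 1 [this]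
      module
    have hx' : y - x' = (y - z) + (t / (t + s)) • (x - x') := by
      have : x' = (t / (t + s) + s / (t + s)) • x' := by
        rw [← add_div, div_self hts.ne', one_smul]
      simp only [z]
      nth_rw 1 [this]
      module
    rw [hx, hx', norm_sub_sq_real, norm_add_sq_real, norm_smul, norm_smul, inner_smul_right,
      inner_smul_right, mul_pow, mul_pow, norm_eq_abs, norm_eq_abs, sq_abs, sq_abs]
    field_simp
    ring
  simp_rw [h, ENNReal.ofReal_mul (exp_pos _).le]
  rw [lintegral_mul_const _ (by fun_prop),
    lintegral_sub_right_eq_self (fun y : Euc n => ENNReal.ofReal (exp (-(t + s) * ‖y‖ ^ 2))) z,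
    lintegral_exp_neg_mul_sq_norm hts, ← ENNReal.ofReal_mul (by positivity)]

/-- A negative power written as a Gamma integral. -/
lemma ofReal_rpow_neg_eq_lintegral {a r : ℝ} (ha : 0 < a) (hr : 0 < r) :
    ENNReal.ofReal (r ^ (-a)) = ENNReal.ofReal (Gamma a)⁻¹ *
      ∫⁻ t in Set.Ioi (0 : ℝ), ENNReal.ofReal (t ^ (a - 1) * exp (-(r * t))) := by
  have := Gamma_pos_of_pos ha
  rw [lintegral_rpow_mul_exp_neg_mul_Ioi ha hr, ← ENNReal.ofReal_mul (by positivity)]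
  congr 1
  field_simp

lemma lintegral_one_add_sq_norm_rpow {n : ℕ} {s : ℝ} (hs0 : 0 < s) (hs : (n : ℝ) / 2 < s) :
    ∫⁻ z : Euc n, ENNReal.ofReal ((1 + ‖z‖ ^ 2) ^ (-s))
      = ENNReal.ofReal (π ^ ((n : ℝ) / 2) * Gamma (s - n / 2) / Gamma s) := by
  have hG := Gamma_pos_of_pos hs0
  have hG' := Gamma_pos_of_pos (sub_pos.2 hs)
  have h (z : Euc n) := ofReal_rpow_neg_eq_lintegral hs0 (r := 1 + ‖z‖ ^ 2) (by positivity)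
  simp_rw [h]
  rw [lintegral_const_mul _ (by fun_prop), lintegral_lintegral_swap (by fun_prop)]
  have h2 : ∀ t ∈ Set.Ioi (0 : ℝ),
      ∫⁻ z : Euc n, ENNReal.ofReal (t ^ (s - 1) * exp (-((1 + ‖z‖ ^ 2) * t)))
      = ENNReal.ofReal (π ^ ((n : ℝ) / 2)) *
        ENNReal.ofReal (t ^ (s - n / 2 - 1) * exp (-(1 * t))) := by
    intro t (ht : 0 < t)
    have : ∀ z : Euc n, ENNReal.ofReal (t ^ (s - 1) * exp (-((1 + ‖z‖ ^ 2) * t)))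
        = ENNReal.ofReal (t ^ (s - 1) * exp (-t)) * ENNReal.ofReal (exp (-t * ‖z‖ ^ 2)) := by
      intro z
      rw [← ENNReal.ofReal_mul (by positivity), mul_assoc, ← exp_add]
      congr 3
      ring
    simp_rw [this]
    rw [lintegral_const_mul _ (by fun_prop), lintegral_exp_neg_mul_sq_norm ht,
      ← ENNReal.ofReal_mul (by positivity), ← ENNReal.ofReal_mul (by positivity),
      div_rpow pi_pos.le ht.le, show s - (n : ℝ) / 2 - 1 = (s - 1) - n / 2 by ring,
      rpow_sub ht (s - 1), one_mul]
    congr 1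
    ring
  rw [setLIntegral_congr_fun measurableSet_Ioi h2, lintegral_const_mul _ (by fun_prop),
    lintegral_rpow_mul_exp_neg_mul_Ioi (sub_pos.2 hs) one_pos, one_rpow, one_mul,
    ← ENNReal.ofReal_mul (by positivity), ← ENNReal.ofReal_mul (by positivity)]
  congr 1
  field_simp

/-- The Beta integral over the half-line. -/
lemma lintegral_beta_Ioi {a b : ℝ} (ha : 0 < a) (hb : 0 < b) :
    ∫⁻ u in Set.Ioi (0 : ℝ), ENNReal.ofReal (u ^ (a - 1) * (1 + u) ^ (-(a + b)))
      = ENNReal.ofReal (Gamma a * Gamma b / Gamma (a + b)) := by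
  have hab : 0 < a + b := by positivity
  have hGa := Gamma_pos_of_pos ha
  have hGb := Gamma_pos_of_pos hb
  have hG := Gamma_pos_of_pos hab
  have h : ∀ u ∈ Set.Ioi (0 : ℝ), ENNReal.ofReal (u ^ (a - 1) * (1 + u) ^ (-(a + b)))
      = ENNReal.ofReal (Gamma (a + b))⁻¹ * ∫⁻ t in Set.Ioi (0 : ℝ),
          ENNReal.ofReal (u ^ (a - 1)) *
            ENNReal.ofReal (t ^ (a + b - 1) * exp (-((1 + u) * t))) := by
    intro u (hu : 0 < u)
    rw [lintegral_const_mul _ (by fun_prop), mul_left_comm,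
      ← ofReal_rpow_neg_eq_lintegral hab (by positivity), ENNReal.ofReal_mul (by positivity)]
  have h2 : ∀ t ∈ Set.Ioi (0 : ℝ), ∫⁻ u in Set.Ioi (0 : ℝ), ENNReal.ofReal (u ^ (a - 1)) *
            ENNReal.ofReal (t ^ (a + b - 1) * exp (-((1 + u) * t)))
      = ENNReal.ofReal (Gamma a) * ENNReal.ofReal (t ^ (b - 1) * exp (-(1 * t))) := by
    intro t (ht : 0 < t)
    have : ∀ u ∈ Set.Ioi (0 : ℝ), ENNReal.ofReal (u ^ (a - 1)) *
            ENNReal.ofReal (t ^ (a + b - 1) * exp (-((1 + u) * t)))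
        = ENNReal.ofReal (t ^ (a + b - 1) * exp (-t)) *
          ENNReal.ofReal (u ^ (a - 1) * exp (-(t * u))) := by
      intro u (hu : 0 < u)
      rw [← ENNReal.ofReal_mul (by positivity), ← ENNReal.ofReal_mul (by positivity),
        show -((1 + u) * t) = -t + -(t * u) by ring, exp_add]
      congr 1
      ring
    rw [setLIntegral_congr_fun measurableSet_Ioi this, lintegral_const_mul _ (by fun_prop),
      lintegral_rpow_mul_exp_neg_mul_Ioi ha ht, ← ENNReal.ofReal_mul (by positivity),
      ← ENNReal.ofReal_mul (by positivity), one_mul,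
      show b - 1 = (a + b - 1) + -a by ring, rpow_add ht]
    congr 1
    ring
  rw [setLIntegral_congr_fun measurableSet_Ioi h, lintegral_const_mul _ (by fun_prop),
    lintegral_lintegral_swap (by fun_prop), setLIntegral_congr_fun measurableSet_Ioi h2,
    lintegral_const_mul _ (by fun_prop), lintegral_rpow_mul_exp_neg_mul_Ioi hb one_pos, one_rpow,
    one_mul, ← ENNReal.ofReal_mul (by positivity), ← ENNReal.ofReal_mul (by positivity)]
  congr 1
  field_simp

lemma ae_ne_point {n : ℕ} (hn : 1 ≤ n) (x : Euc n) : ∀ᵐ y : Euc n, y ≠ x := by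
  have : Nonempty (Fin n) := ⟨⟨0, hn⟩⟩
  rw [ae_iff]
  simp

/-- Composition of two Riesz kernels. -/
lemma lintegral_riesz_mul_riesz {n : ℕ} (hn : 1 ≤ n) {a b : ℝ} (ha : 0 < a) (han : a < n)
    (hb : 0 < b) (hbn : b < n) (hab : (n : ℝ) < a + b) {x x' : Euc n} (hx : x ≠ x') :
    ∫⁻ y : Euc n, ENNReal.ofReal (‖y - x‖ ^ (-a)) * ENNReal.ofReal (‖y - x'‖ ^ (-b))
      = ENNReal.ofReal (π ^ ((n : ℝ) / 2) * (Gamma ((n - a) / 2) * Gamma ((n - b) / 2) *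
          Gamma ((a + b - n) / 2) / (Gamma (a / 2) * Gamma (b / 2) * Gamma (n - (a + b) / 2)))) *
        ENNReal.ofReal (‖x - x'‖ ^ (n - a - b)) := by
  have hD : 0 < ‖x - x'‖ := norm_pos_iff.2 (sub_ne_zero.2 hx)
  set D := ‖x - x'‖ with hDdef
  have ha2 : 0 < a / 2 := by positivity
  have hb2 : 0 < b / 2 := by positivity
  have hc : 0 < (a + b - n) / 2 := by linarith
  have hna : 0 < (n - a) / 2 := by linarith
  have hnb : 0 < (n - b) / 2 := by linarith
  have hGa := Gamma_pos_of_pos ha2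
  have hGb := Gamma_pos_of_pos hb2
  have hGc := Gamma_pos_of_pos hc
  have hGna := Gamma_pos_of_pos hna
  have hGnb := Gamma_pos_of_pos hnb
  have hGn : 0 < Gamma (n - (a + b) / 2) := Gamma_pos_of_pos (by linarith)
  have hrepr : ∀ᵐ y : Euc n,
      ENNReal.ofReal (‖y - x‖ ^ (-a)) * ENNReal.ofReal (‖y - x'‖ ^ (-b))
      = ENNReal.ofReal ((Gamma (a / 2))⁻¹ * (Gamma (b / 2))⁻¹) *
        ∫⁻ t in Set.Ioi (0 : ℝ), ∫⁻ u in Set.Ioi (0 : ℝ),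
          ENNReal.ofReal (t ^ ((a + b) / 2 - 1) * u ^ (b / 2 - 1)) *
          ENNReal.ofReal (exp (-(t * ‖y - x‖ ^ 2)) * exp (-(t * u * ‖y - x'‖ ^ 2))) := by
    filter_upwards [ae_ne_point hn x, ae_ne_point hn x'] with y hy hy'
    have h1 : 0 < ‖y - x‖ := norm_pos_iff.2 (sub_ne_zero.2 hy)
    have h2 : 0 < ‖y - x'‖ := norm_pos_iff.2 (sub_ne_zero.2 hy')
    have e1 : ‖y - x‖ ^ (-a) = (‖y - x‖ ^ 2) ^ (-(a / 2)) := by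
      rw [← rpow_natCast, ← rpow_mul h1.le]
      congr 1
      push_cast
      ring
    rw [e1, ofReal_rpow_neg_eq_lintegral ha2 (by positivity), mul_assoc,
      ← lintegral_mul_const _ (by fun_prop), ENNReal.ofReal_mul (by positivity), mul_assoc]
    congr 1
    rw [← lintegral_const_mul' _ _ ENNReal.ofReal_ne_top]
    refine setLIntegral_congr_fun measurableSet_Ioi fun t (ht : 0 < t) => ?_
    have e2 : ‖y - x'‖ ^ (-b) = t ^ (b / 2) * (t * ‖y - x'‖ ^ 2) ^ (-(b / 2)) := by
      rw [mul_rpow ht.le (by positivity), ← mul_assoc, ← rpow_add ht, ← rpow_natCast,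
        ← rpow_mul h2.le, add_neg_cancel, rpow_zero, one_mul]
      congr 1
      push_cast
      ring
    rw [e2, ENNReal.ofReal_mul (p := t ^ (b / 2)) (by positivity),
      ofReal_rpow_neg_eq_lintegral hb2 (by positivity), ← mul_assoc, mul_left_comm]
    congr 1
    rw [← ENNReal.ofReal_mul (by positivity), ← lintegral_const_mul _ (by fun_prop)]
    refine setLIntegral_congr_fun measurableSet_Ioi fun u (hu : 0 < u) => ?_
    rw [← ENNReal.ofReal_mul (by positivity), ← ENNReal.ofReal_mul (by positivity)]
    congr 1
    rw [show (a + b) / 2 - 1 = (a / 2 - 1) + b / 2 by ring, rpow_add ht,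
      mul_comm (‖y - x‖ ^ 2) t, mul_right_comm t (‖y - x'‖ ^ 2) u]
    ring
  rw [lintegral_congr_ae hrepr, lintegral_const_mul _ (by fun_prop),
    lintegral_lintegral_swap (by fun_prop)]
  have hgauss : ∀ t ∈ Set.Ioi (0 : ℝ), (∫⁻ y : Euc n, ∫⁻ u in Set.Ioi (0 : ℝ),
          ENNReal.ofReal (t ^ ((a + b) / 2 - 1) * u ^ (b / 2 - 1)) *
          ENNReal.ofReal (exp (-(t * ‖y - x‖ ^ 2)) * exp (-(t * u * ‖y - x'‖ ^ 2))))
      = ∫⁻ u in Set.Ioi (0 : ℝ),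
          ENNReal.ofReal (π ^ ((n : ℝ) / 2) * u ^ (b / 2 - 1) * (1 + u) ^ (-((n : ℝ) / 2))) *
          ENNReal.ofReal (t ^ ((a + b - n) / 2 - 1) * exp (-(u * D ^ 2 / (1 + u) * t))) := by
    intro t (ht : 0 < t)
    rw [lintegral_lintegral_swap (by fun_prop)]
    refine setLIntegral_congr_fun measurableSet_Ioi fun u (hu : 0 < u) => ?_
    rw [lintegral_const_mul _ (by fun_prop), lintegral_exp_mul_exp ht (by positivity),
      ← ENNReal.ofReal_mul (by positivity), ← ENNReal.ofReal_mul (by positivity), ← hDdef]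
    congr 1
    rw [show t + t * u = t * (1 + u) by ring, div_rpow pi_pos.le (by positivity),
      mul_rpow ht.le (by positivity), rpow_neg (by positivity),
      show (a + b - n) / 2 - 1 = ((a + b) / 2 - 1) - n / 2 by ring,
      rpow_sub ht ((a + b) / 2 - 1),
      show t * (t * u) / (t * (1 + u)) * D ^ 2 = u * D ^ 2 / (1 + u) * t by field_simp]
    ring
  rw [setLIntegral_congr_fun measurableSet_Ioi hgauss, lintegral_lintegral_swap (by fun_prop)]
  have hgam : ∀ u ∈ Set.Ioi (0 : ℝ), (∫⁻ t in Set.Ioi (0 : ℝ),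
          ENNReal.ofReal (π ^ ((n : ℝ) / 2) * u ^ (b / 2 - 1) * (1 + u) ^ (-((n : ℝ) / 2))) *
          ENNReal.ofReal (t ^ ((a + b - n) / 2 - 1) * exp (-(u * D ^ 2 / (1 + u) * t))))
      = ENNReal.ofReal (π ^ ((n : ℝ) / 2) * D ^ (n - a - b) * Gamma ((a + b - n) / 2)) *
        ENNReal.ofReal (u ^ ((n - a) / 2 - 1) * (1 + u) ^ (-((n - a) / 2 + (n - b) / 2))) := by
    intro u (hu : 0 < u)
    rw [lintegral_const_mul _ (by fun_prop),
      lintegral_rpow_mul_exp_neg_mul_Ioi hc (by positivity),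
      ← ENNReal.ofReal_mul (by positivity), ← ENNReal.ofReal_mul (by positivity)]
    congr 1
    rw [div_rpow (by positivity) (by positivity), mul_rpow hu.le (by positivity),
      ← rpow_natCast D 2, ← rpow_mul hD.le,
      show ((2 : ℕ) : ℝ) * -((a + b - n) / 2) = n - a - b by push_cast; ring,
      show (n - a) / 2 - 1 = (b / 2 - 1) + -((a + b - n) / 2) by ring, rpow_add hu,
      show -(((n : ℝ) - a) / 2 + (n - b) / 2) = -(n / 2) - -((a + b - n) / 2) by ring,
      rpow_sub (show 0 < 1 + u by positivity)]
    ring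
  rw [setLIntegral_congr_fun measurableSet_Ioi hgam, lintegral_const_mul _ (by fun_prop),
    lintegral_beta_Ioi hna hnb, ← ENNReal.ofReal_mul (by positivity),
    ← ENNReal.ofReal_mul (by positivity), ← ENNReal.ofReal_mul (by positivity),
    show ((n : ℝ) - a) / 2 + (n - b) / 2 = n - (a + b) / 2 by ring]
  congr 1
  field_simp

/-- The Kelvin transform of weight `s` with respect to the sphere of centre `c` and radius `r`. -/
def kelvin {n : ℕ} (c : Euc n) (r s : ℝ) (f : Euc n → ℝ≥0∞) (x : Euc n) : ℝ≥0∞ :=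
  ENNReal.ofReal ((r / dist x c) ^ (2 * s)) * f (inversion c r x)

lemma measurable_inversion {n : ℕ} (c : Euc n) (r : ℝ) : Measurable (inversion c r) := by
  unfold EuclideanGeometry.inversion
  simp only [vsub_eq_sub, vadd_eq_add]
  fun_prop

lemma measurable_kelvin {n : ℕ} {c : Euc n} {r s : ℝ} {f : Euc n → ℝ≥0∞} (hf : Measurable f) :
    Measurable (kelvin c r s f) := by
  have hpre : Measurable fun x : Euc n => ENNReal.ofReal ((r / dist x c) ^ (2 * s)) := by fun_prop
  exact hpre.mul (hf.comp (measurable_inversion c r))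

lemma kelvin_kelvin {n : ℕ} {c : Euc n} {r : ℝ} (hr : 0 < r) (s : ℝ) (f : Euc n → ℝ≥0∞)
    {x : Euc n} (hx : x ≠ c) : kelvin c r s (kelvin c r s f) x = f x := by
  have hd : 0 < dist x c := dist_pos.2 hx
  unfold kelvin
  rw [EuclideanGeometry.inversion_inversion c hr.ne', ← mul_assoc,
    EuclideanGeometry.dist_inversion_center, ← ENNReal.ofReal_mul (by positivity),
    ← mul_rpow (by positivity) (by positivity)]
  have : r / dist x c * (r / (r ^ 2 / dist x c)) = 1 := by field_simp
  simp [this]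

/-- Change of variables under an inversion. -/
lemma lintegral_kelvin {n : ℕ} (hn : 1 ≤ n) (c : Euc n) {r : ℝ} (hr : 0 < r)
    (G : Euc n → ℝ≥0∞) : ∫⁻ x, kelvin c r n G x = ∫⁻ x, G x := by
  have hc : ({c}ᶜ : Set (Euc n)) =ᵐ[volume] Set.univ :=
    Filter.eventuallyEq_set.2 ((ae_ne_point hn c).mono fun y hy => by simpa using hy)
  have hs : MeasurableSet ({c}ᶜ : Set (Euc n)) := (measurableSet_singleton c).compl
  have himg : inversion c r '' {c}ᶜ = ({c}ᶜ : Set (Euc n)) := by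
    rw [Set.image_compl_eq (EuclideanGeometry.inversion_bijective c hr.ne')]
    simp
  have key := lintegral_image_eq_lintegral_abs_det_fderiv_mul volume hs
    (fun x hx => (EuclideanGeometry.hasFDerivAt_inversion (R := r)
      (by simpa using hx : x ≠ c)).hasFDerivWithinAt)
    (EuclideanGeometry.inversion_injective c hr.ne').injOn G
  rw [himg, setLIntegral_congr hc, setLIntegral_congr hc, setLIntegral_univ,
    setLIntegral_univ] at key
  rw [key]
  refine lintegral_congr_ae ((ae_ne_point hn c).mono fun x hx => ?_)
  have hd : 0 < dist x c := dist_pos.2 hx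
  simp only [kelvin]
  congr 2
  rw [ContinuousLinearMap.det, ContinuousLinearMap.toLinearMap_smul, LinearMap.det_smul]
  have hdet : |LinearMap.det (((ℝ ∙ (x - c))ᗮ.reflection : Euc n →L[ℝ] Euc n) : Euc n →ₗ[ℝ] Euc n)|
      = 1 := by
    have := (ℝ ∙ (x - c))ᗮ.det_reflection (𝕜 := ℝ)
    exact (congrArg abs this).trans (by simp)
  rw [abs_mul, hdet, mul_one, finrank_euclideanSpace_fin, abs_of_nonneg (by positivity),
    ← pow_mul, ← rpow_natCast]
  push_cast
  rfl

/-- One of the two sides of the sphere of centre `c` and radius `r`: the ball if `0 < τ`, the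
exterior domain if `τ < 0`. -/
def sphereSide {n : ℕ} (c : Euc n) (r τ : ℝ) : Set (Euc n) := {x | 0 < τ * (r ^ 2 - dist x c ^ 2)}

lemma measurableSet_sphereSide {n : ℕ} (c : Euc n) (r τ : ℝ) :
    MeasurableSet (sphereSide c r τ) :=
  measurableSet_lt measurable_const (by fun_prop)

lemma sq_sub_dist_inversion {n : ℕ} {c x : Euc n} {r : ℝ} (hx : x ≠ c) :
    r ^ 2 - dist (inversion c r x) c ^ 2
      = -(r ^ 2 / dist x c ^ 2) * (r ^ 2 - dist x c ^ 2) := by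
  have hd : 0 < dist x c := dist_pos.2 hx
  rw [EuclideanGeometry.dist_inversion_center]
  field_simp
  ring

lemma inversion_notMem_sphereSide {n : ℕ} {c x : Euc n} {r τ : ℝ} (hr : 0 < r) (hx : x ≠ c)
    (h : x ∈ sphereSide c r τ) : inversion c r x ∉ sphereSide c r τ := by
  have hd : 0 < dist x c := dist_pos.2 hx
  have hp : 0 < r ^ 2 / dist x c ^ 2 := by positivity
  simp only [sphereSide, Set.mem_ofPred_eq, not_lt] at h ⊢
  rw [sq_sub_dist_inversion hx]
  nlinarith

/-- Folding an integral onto one side of a sphere. -/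
lemma lintegral_eq_sphereSide {n : ℕ} (hn : 1 ≤ n) (c : Euc n) {r τ : ℝ} (hr : 0 < r)
    (hτ : τ ≠ 0) {G : Euc n → ℝ≥0∞} (hG : Measurable G) :
    ∫⁻ x, G x = ∫⁻ x in sphereSide c r τ, (G x + kelvin c r n G x) := by
  have hS := measurableSet_sphereSide c r τ
  rw [← lintegral_add_compl G hS, lintegral_add_left hG]
  congr 1
  rw [← lintegral_indicator hS.compl, ← lintegral_kelvin hn c hr, ← lintegral_indicator hS]
  refine lintegral_congr_ae ?_
  have hsph : ∀ᵐ x : Euc n, x ∉ Metric.sphere c r := by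
    have : volume (Metric.sphere c r) = 0 := Measure.addHaar_sphere_of_ne_zero volume c hr.ne'
    exact measure_eq_zero_iff_ae_notMem.1 this
  filter_upwards [ae_ne_point hn c, hsph] with x hx hx'
  have hd : 0 < dist x c := dist_pos.2 hx
  have hp : 0 < r ^ 2 / dist x c ^ 2 := by positivity
  by_cases h : x ∈ sphereSide c r τ
  · have hinv := inversion_notMem_sphereSide hr hx h
    simp [kelvin, h, hinv]
  · have hinv : inversion c r x ∈ sphereSide c r τ := by
      have hne : τ * (r ^ 2 - dist x c ^ 2) ≠ 0 := by
        refine mul_ne_zero hτ (sub_ne_zero.2 fun he => hx' ?_)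
        exact ((pow_left_inj₀ hr.le hd.le two_ne_zero).1 he).symm
      simp only [sphereSide, Set.mem_ofPred_eq, not_lt] at h ⊢
      rw [sq_sub_dist_inversion hx]
      have : τ * (r ^ 2 - dist x c ^ 2) < 0 := lt_of_le_of_ne h hne
      nlinarith
    simp [kelvin, h, hinv]

/-- The Riesz kernel with exponent `2 s - 2 n`, for which the Kelvin transform of weight `s` is a
symmetry. -/
def rieszKernel {n : ℕ} (s : ℝ) (x y : Euc n) : ℝ≥0∞ :=
  ENNReal.ofReal (dist x y ^ (2 * s - 2 * n))

/-- The Riesz energy of a function. -/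
def rieszEnergy {n : ℕ} (s : ℝ) (f : Euc n → ℝ≥0∞) : ℝ≥0∞ :=
  ∫⁻ x, ∫⁻ y, f x * f y * rieszKernel s x y

/-- The Riesz kernel between `x` and the mirror image of `y`. -/
def mirrorKernel {n : ℕ} (c : Euc n) (r s : ℝ) (x y : Euc n) : ℝ≥0∞ :=
  ENNReal.ofReal ((dist x (inversion c r y) * dist y c / r) ^ (2 * s - 2 * n))

/-- Two-point symmetrization with respect to a side of a sphere. -/
def polarize {n : ℕ} (c : Euc n) (r τ s : ℝ) (f : Euc n → ℝ≥0∞) (x : Euc n) : ℝ≥0∞ :=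
  open Classical in
  if x ∈ sphereSide c r τ then max (f x) (kelvin c r s f x) else min (f x) (kelvin c r s f x)

lemma measurable_polarize {n : ℕ} {c : Euc n} {r τ s : ℝ} {f : Euc n → ℝ≥0∞}
    (hf : Measurable f) : Measurable (polarize c r τ s f) := by
  classical
  have hk : Measurable (kelvin c r s f) := measurable_kelvin hf
  exact Measurable.ite (measurableSet_sphereSide c r τ) (hf.max hk) (hf.min hk)

lemma measurable_rieszKernel {n : ℕ} (s : ℝ) :
    Measurable fun z : Euc n × Euc n => rieszKernel s z.1 z.2 := by
  unfold rieszKernel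
  fun_prop

lemma polarize_of_mem {n : ℕ} {c : Euc n} {r τ s : ℝ} {f : Euc n → ℝ≥0∞} {x : Euc n}
    (hx : x ∈ sphereSide c r τ) :
    polarize c r τ s f x = max (f x) (kelvin c r s f x) := by
  simp [polarize, hx]

lemma kelvin_polarize_of_mem {n : ℕ} {c : Euc n} {r τ s : ℝ} (hr : 0 < r) {f : Euc n → ℝ≥0∞}
    {x : Euc n} (hxc : x ≠ c) (hx : x ∈ sphereSide c r τ) :
    kelvin c r s (polarize c r τ s f) x = min (f x) (kelvin c r s f x) := by
  have h := inversion_notMem_sphereSide hr hxc hx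
  have hk := kelvin_kelvin hr s f hxc
  rw [min_comm, ← hk]
  simp only [kelvin, polarize, h, if_false]
  exact (mul_right_mono (a := ENNReal.ofReal ((r / dist x c) ^ (2 * s)))).map_min

lemma kernel_factor {n : ℕ} {r d : ℝ} (hr : 0 < r) (hd : 0 < d) (s : ℝ) {D : ℝ} (hD : 0 ≤ D) :
    (r / d) ^ (2 * (n : ℝ)) * D ^ (2 * s - 2 * n)
      = (r / d) ^ (2 * s) * (D * d / r) ^ (2 * s - 2 * n) := by
  have hrd : 0 < r / d := by positivity
  rw [mul_div_assoc, mul_rpow hD (by positivity), ← inv_div r d, inv_rpow hrd.le,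
    show (2 : ℝ) * s = 2 * n + (2 * s - 2 * n) by ring, rpow_add hrd, add_sub_cancel_left]
  have := (rpow_pos_of_pos hrd (2 * s - 2 * n)).ne'
  field_simp

lemma rieszEnergy_eq_sphereSide {n : ℕ} (hn : 1 ≤ n) (c : Euc n) {r τ : ℝ} (hr : 0 < r)
    (hτ : τ ≠ 0) (s : ℝ) {f : Euc n → ℝ≥0∞} (hf : Measurable f) :
    rieszEnergy s f = ∫⁻ x in sphereSide c r τ, ∫⁻ y in sphereSide c r τ,
      ((f x * f y + kelvin c r s f x * kelvin c r s f y) * rieszKernel s x y +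
        (f x * kelvin c r s f y + kelvin c r s f x * f y) * mirrorKernel c r s x y) := by
  have hKx (x : Euc n) : Measurable fun y => rieszKernel s x y := by
    unfold rieszKernel
    fun_prop
  have hmeas : Measurable fun z : Euc n × Euc n => f z.1 * f z.2 * rieszKernel s z.1 z.2 :=
    ((hf.comp measurable_fst).mul (hf.comp measurable_snd)).mul (measurable_rieszKernel s)
  have hinner : Measurable fun x => ∫⁻ y, f x * f y * rieszKernel s x y :=
    hmeas.lintegral_prod_right'
  have hσ := measurable_inversion c r
  unfold rieszEnergy
  rw [lintegral_eq_sphereSide hn c hr hτ hinner]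
  refine lintegral_congr_ae ?_
  filter_upwards [ae_restrict_of_ae (ae_ne_point hn c)] with x hx
  have hdx : 0 < dist x c := dist_pos.2 hx
  have hfold (z : Euc n) := lintegral_eq_sphereSide hn c hr hτ
    (show Measurable fun y => f z * f y * rieszKernel s z y by fun_prop)
  simp only [kelvin]
  rw [hfold x, hfold (inversion c r x), ← lintegral_const_mul' _ _ ENNReal.ofReal_ne_top,
    ← lintegral_add_left]
  · refine lintegral_congr_ae ?_
    filter_upwards [ae_restrict_of_ae (ae_ne_point hn c)] with y hy
    have hdy : 0 < dist y c := dist_pos.2 hy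
    simp only [kelvin, rieszKernel, mirrorKernel]
    have e1 : ENNReal.ofReal ((r / dist y c) ^ (2 * (n : ℝ))) *
        ENNReal.ofReal (dist x (inversion c r y) ^ (2 * s - 2 * n))
        = ENNReal.ofReal ((r / dist y c) ^ (2 * s)) *
          ENNReal.ofReal ((dist x (inversion c r y) * dist y c / r) ^ (2 * s - 2 * n)) := by
      rw [← ENNReal.ofReal_mul (by positivity), ← ENNReal.ofReal_mul (by positivity),
        kernel_factor hr hdy s dist_nonneg]
    have e2 : ENNReal.ofReal ((r / dist x c) ^ (2 * (n : ℝ))) *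
        ENNReal.ofReal (dist (inversion c r x) y ^ (2 * s - 2 * n))
        = ENNReal.ofReal ((r / dist x c) ^ (2 * s)) *
          ENNReal.ofReal ((dist x (inversion c r y) * dist y c / r) ^ (2 * s - 2 * n)) := by
      rw [← ENNReal.ofReal_mul (by positivity), ← ENNReal.ofReal_mul (by positivity),
        kernel_factor hr hdx s dist_nonneg,
        EuclideanGeometry.dist_inversion_mul_dist_center_eq hx hy]
    have e3 : ENNReal.ofReal ((r / dist x c) ^ (2 * (n : ℝ))) *
        (ENNReal.ofReal ((r / dist y c) ^ (2 * (n : ℝ))) *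
        ENNReal.ofReal (dist (inversion c r x) (inversion c r y) ^ (2 * s - 2 * n)))
        = ENNReal.ofReal ((r / dist x c) ^ (2 * s)) * (ENNReal.ofReal ((r / dist y c) ^ (2 * s)) *
          ENNReal.ofReal (dist x y ^ (2 * s - 2 * n))) := by
      rw [← ENNReal.ofReal_mul (by positivity), ← ENNReal.ofReal_mul (by positivity),
        ← ENNReal.ofReal_mul (by positivity), ← ENNReal.ofReal_mul (by positivity),
        kernel_factor hr hdy s dist_nonneg, mul_left_comm,
        kernel_factor hr hdx s (by positivity),
        EuclideanGeometry.dist_inversion_inversion hx hy]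
      have : r ^ 2 / (dist x c * dist y c) * dist x y * dist y c / r * dist x c / r
          = dist x y := by field_simp
      rw [this]
      ring_nf
    generalize ENNReal.ofReal ((r / dist x c) ^ (2 * (n : ℝ))) = A at *
    generalize ENNReal.ofReal ((r / dist y c) ^ (2 * (n : ℝ))) = B at *
    generalize ENNReal.ofReal ((r / dist x c) ^ (2 * s)) = A' at *
    generalize ENNReal.ofReal ((r / dist y c) ^ (2 * s)) = B' at *
    generalize ENNReal.ofReal (dist x (inversion c r y) ^ (2 * s - 2 * n)) = K₁ at *
    generalize ENNReal.ofReal (dist (inversion c r x) y ^ (2 * s - 2 * n)) = K₂ at *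
    generalize ENNReal.ofReal (dist (inversion c r x) (inversion c r y) ^ (2 * s - 2 * n)) = K₃
      at *
    generalize ENNReal.ofReal ((dist x (inversion c r y) * dist y c / r) ^ (2 * s - 2 * n)) = M
      at *
    generalize ENNReal.ofReal (dist x y ^ (2 * s - 2 * n)) = K at *
    generalize f x = u, f y = v, f (inversion c r x) = u', f (inversion c r y) = v'
    calc u * v * K + B * (u * v' * K₁) + A * (u' * v * K₂ + B * (u' * v' * K₃))
        = u * v * K + u * v' * (B * K₁) + (u' * v * (A * K₂) + u' * v' * (A * (B * K₃))) := by ring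
      _ = _ := by
        rw [e1, e2, e3]
        ring
  · have := measurable_kelvin (c := c) (r := r) (s := n)
      (show Measurable fun y => f x * f y * rieszKernel s x y by fun_prop)
    fun_prop

lemma mul_add_mul_le_mul_add_mul_ennreal {u u' v v' : ℝ≥0∞} (hu : u ≤ u') (hv : v' ≤ v) :
    u * v + u' * v' ≤ u' * v + u * v' := by
  obtain ⟨a, rfl⟩ := exists_add_of_le hu
  obtain ⟨b, rfl⟩ := exists_add_of_le hv
  calc u * (v' + b) + (u + a) * v' ≤ u * (v' + b) + (u + a) * v' + a * b := le_self_add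
    _ = _ := by ring

lemma crossed_mul_le {u u' v v' K M : ℝ≥0∞} (hu : u ≤ u') (hv : v' ≤ v) (hM : M ≤ K) :
    (u * v + u' * v') * K + (u * v' + u' * v) * M
      ≤ (u' * v + u * v') * K + (u' * v' + u * v) * M := by
  obtain ⟨d, rfl⟩ := exists_add_of_le hM
  calc (u * v + u' * v') * (M + d) + (u * v' + u' * v) * M
      = (u * v + u' * v' + u * v' + u' * v) * M + (u * v + u' * v') * d := by ring
    _ ≤ (u * v + u' * v' + u * v' + u' * v) * M + (u' * v + u * v') * d := by
        gcongr _ + ?_ * _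
        exact mul_add_mul_le_mul_add_mul_ennreal hu hv
    _ = _ := by ring

/-- The four-point inequality behind two-point symmetrization. -/
lemma four_point_le {u u' v v' K M : ℝ≥0∞} (hM : M ≤ K) :
    (u * v + u' * v') * K + (u * v' + u' * v) * M
      ≤ (max u u' * max v v' + min u u' * min v v') * K +
        (max u u' * min v v' + min u u' * max v v') * M := by
  rcases le_total u u' with hu | hu <;> rcases le_total v v' with hv | hv <;>
    simp only [hu, hv, max_eq_left, max_eq_right, min_eq_left, min_eq_right]
  · exact le_of_eq (by ring)
  · exact crossed_mul_le hu hv hM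
  · have := crossed_mul_le (u := u') (u' := u) (v := v') (v' := v) hu hv hM
    calc _ = _ := by ring
      _ ≤ _ := this
  · exact le_rfl

lemma mirror_dist_sq {n : ℕ} {c x y : Euc n} {r : ℝ} (hr : 0 < r) (hy : y ≠ c) :
    (dist x (inversion c r y) * dist y c / r) ^ 2
      = dist x y ^ 2 + (r ^ 2 - dist x c ^ 2) * (r ^ 2 - dist y c ^ 2) / r ^ 2 := by
  have hd : 0 < dist y c := dist_pos.2 hy
  have h1 : dist x (inversion c r y) ^ 2
      = dist x c ^ 2 - 2 * ((r / dist y c) ^ 2 * inner ℝ (x - c) (y - c))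
        + ((r / dist y c) ^ 2 * dist y c) ^ 2 := by
    have : x - inversion c r y = (x - c) - (r / dist y c) ^ 2 • (y - c) := by
      simp only [EuclideanGeometry.inversion, vsub_eq_sub, vadd_eq_add]
      abel
    rw [dist_eq_norm, this, norm_sub_sq_real, inner_smul_right, norm_smul, Real.norm_eq_abs,
      abs_of_nonneg (by positivity), ← dist_eq_norm, ← dist_eq_norm]
  have h2 : dist x y ^ 2 = dist x c ^ 2 - 2 * inner ℝ (x - c) (y - c) + dist y c ^ 2 := by
    have : x - y = (x - c) - (y - c) := by abel
    rw [dist_eq_norm, this, norm_sub_sq_real, ← dist_eq_norm, ← dist_eq_norm]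
  rw [div_pow, mul_pow, h1, h2]
  field_simp
  ring

lemma mirrorKernel_le {n : ℕ} {c x y : Euc n} {r τ s : ℝ} (hr : 0 < r) (hs : s < n)
    (hy : y ≠ c) (hxy : x ≠ y) (hxS : x ∈ sphereSide c r τ) (hyS : y ∈ sphereSide c r τ) :
    mirrorKernel c r s x y ≤ rieszKernel s x y := by
  refine ENNReal.ofReal_le_ofReal ?_
  refine rpow_le_rpow_of_nonpos (dist_pos.2 hxy) ?_ (by linarith)
  refine (sq_le_sq₀ dist_nonneg (by positivity)).1 ?_
  rw [mirror_dist_sq hr hy]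
  have : 0 ≤ (r ^ 2 - dist x c ^ 2) * (r ^ 2 - dist y c ^ 2) := by
    simp only [sphereSide, Set.mem_ofPred_eq] at hxS hyS
    rcases lt_or_ge 0 τ with h | h
    · have h1 := pos_of_mul_pos_right hxS h.le
      have h2 := pos_of_mul_pos_right hyS h.le
      positivity
    · have h1 := neg_of_mul_pos_right hxS h
      have h2 := neg_of_mul_pos_right hyS h
      exact (mul_pos_of_neg_of_neg h1 h2).le
  have : 0 ≤ (r ^ 2 - dist x c ^ 2) * (r ^ 2 - dist y c ^ 2) / r ^ 2 := by positivity
  linarith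

/-- Two-point symmetrization does not decrease the Riesz energy. -/
lemma rieszEnergy_le_polarize {n : ℕ} (hn : 1 ≤ n) (c : Euc n) {r τ s : ℝ} (hr : 0 < r)
    (hτ : τ ≠ 0) (hs : s < n) {f : Euc n → ℝ≥0∞} (hf : Measurable f) :
    rieszEnergy s f ≤ rieszEnergy s (polarize c r τ s f) := by
  have hS := measurableSet_sphereSide c r τ
  rw [rieszEnergy_eq_sphereSide hn c hr hτ s hf,
    rieszEnergy_eq_sphereSide hn c hr hτ s (measurable_polarize hf)]
  refine lintegral_mono_ae ?_
  filter_upwards [ae_restrict_of_ae (ae_ne_point hn c), ae_restrict_mem hS] with x hx hxS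
  refine lintegral_mono_ae ?_
  filter_upwards [ae_restrict_of_ae (ae_ne_point hn c), ae_restrict_mem hS,
    ae_restrict_of_ae (ae_ne_point hn x)] with y hy hyS hxy
  rw [polarize_of_mem hxS, polarize_of_mem hyS, kelvin_polarize_of_mem hr hx hxS,
    kelvin_polarize_of_mem hr hy hyS]
  exact four_point_le (mirrorKernel_le hr hs hy hxy.symm hxS hyS)

lemma kelvin_rpow {n : ℕ} {c : Euc n} {r s p : ℝ} (hp : 0 ≤ p) (hsp : s * p = n) (hr : 0 ≤ r)
    (f : Euc n → ℝ≥0∞) (x : Euc n) :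
    kelvin c r n (fun x => f x ^ p) x = kelvin c r s f x ^ p := by
  unfold kelvin
  rw [ENNReal.mul_rpow_of_nonneg _ _ hp, ENNReal.ofReal_rpow_of_nonneg (by positivity) hp,
    ← rpow_mul (by positivity), mul_assoc, hsp]

/-- Two-point symmetrization preserves the conformally invariant `L^p` norm. -/
lemma lintegral_polarize_rpow {n : ℕ} (hn : 1 ≤ n) (c : Euc n) {r τ s p : ℝ} (hr : 0 < r)
    (hτ : τ ≠ 0) (hp : 0 ≤ p) (hsp : s * p = n) {f : Euc n → ℝ≥0∞} (hf : Measurable f) :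
    ∫⁻ x, polarize c r τ s f x ^ p = ∫⁻ x, f x ^ p := by
  have hS := measurableSet_sphereSide c r τ
  rw [lintegral_eq_sphereSide hn c hr hτ (hf.pow_const p),
    lintegral_eq_sphereSide hn c hr hτ ((measurable_polarize hf).pow_const p)]
  refine lintegral_congr_ae ?_
  filter_upwards [ae_restrict_of_ae (ae_ne_point hn c), ae_restrict_mem hS] with x hx hxS
  rw [kelvin_rpow hp hsp hr.le, kelvin_rpow hp hsp hr.le, polarize_of_mem hxS,
    kelvin_polarize_of_mem hr hx hxS, (ENNReal.monotone_rpow_of_nonneg hp).map_max,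
    (ENNReal.monotone_rpow_of_nonneg hp).map_min, max_add_min]

/-- The weight that makes the square of `(1 + |x|²) ^ (-s)` comparable to its `L^(n/s)` density. -/
def sphereWeight {n : ℕ} (s : ℝ) (x : Euc n) : ℝ≥0∞ :=
  ENNReal.ofReal ((1 + ‖x‖ ^ 2) ^ (2 * s - n))

lemma measurable_sphereWeight {n : ℕ} (s : ℝ) : Measurable (sphereWeight (n := n) s) := by
  unfold sphereWeight
  fun_prop

/-- The weight `sphereWeight` transported by an inversion. -/
def mirrorWeight {n : ℕ} (c : Euc n) (r s : ℝ) (x : Euc n) : ℝ≥0∞ :=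
  ENNReal.ofReal (((1 + ‖inversion c r x‖ ^ 2) * (dist x c / r) ^ 2) ^ (2 * s - n))

lemma kelvin_sq_mul_sphereWeight {n : ℕ} {c x : Euc n} {r s : ℝ} (hr : 0 < r) (hx : x ≠ c)
    (f : Euc n → ℝ≥0∞) :
    kelvin c r n (fun x => f x ^ 2 * sphereWeight s x) x
      = kelvin c r s f x ^ 2 * mirrorWeight c r s x := by
  have hd : 0 < dist x c := dist_pos.2 hx
  have hrd : 0 < r / dist x c := by positivity
  have key : (r / dist x c) ^ (2 * (n : ℝ)) * (1 + ‖inversion c r x‖ ^ 2) ^ (2 * s - n)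
      = ((r / dist x c) ^ (2 * s)) ^ 2 *
        ((1 + ‖inversion c r x‖ ^ 2) * (dist x c / r) ^ 2) ^ (2 * s - n) := by
    rw [mul_rpow (by positivity) (by positivity), ← inv_div r, ← rpow_natCast (r / dist x c)⁻¹,
      ← rpow_mul (by positivity), inv_rpow hrd.le, ← rpow_natCast ((r / dist x c) ^ (2 * s)),
      ← rpow_mul hrd.le, show 2 * s * ((2 : ℕ) : ℝ) = 2 * n + (2 : ℕ) * (2 * s - n) by
        push_cast; ring, rpow_add hrd]
    have := (rpow_pos_of_pos hrd ((2 : ℕ) * (2 * s - n))).ne'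
    field_simp
  simp only [kelvin, sphereWeight, mirrorWeight]
  have key' := congrArg ENNReal.ofReal key
  rw [ENNReal.ofReal_mul (by positivity), ENNReal.ofReal_mul (by positivity),
    ENNReal.ofReal_pow (by positivity)] at key'
  calc _ = f (inversion c r x) ^ 2 * (ENNReal.ofReal ((r / dist x c) ^ (2 * (n : ℝ))) *
        ENNReal.ofReal ((1 + ‖inversion c r x‖ ^ 2) ^ (2 * s - n))) := by ring
    _ = _ := by
      rw [key']
      ring

lemma one_add_sq_norm_inversion {n : ℕ} {c x : Euc n} {r τ : ℝ} (hr : 0 < r)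
    (hrτ : r ^ 2 = 1 + τ + ‖c‖ ^ 2) (hx : x ≠ c) :
    (1 + ‖inversion c r x‖ ^ 2) * (dist x c / r) ^ 2
      = 1 + ‖x‖ ^ 2 + τ * (r ^ 2 - dist x c ^ 2) / r ^ 2 := by
  have hd : 0 < dist x c := dist_pos.2 hx
  have h1 : ‖inversion c r x‖ ^ 2
      = ((r / dist x c) ^ 2 * dist x c) ^ 2 + 2 * ((r / dist x c) ^ 2 * inner ℝ (x - c) c)
        + ‖c‖ ^ 2 := by
    simp only [EuclideanGeometry.inversion, vsub_eq_sub, vadd_eq_add]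
    rw [norm_add_sq_real, inner_smul_left, norm_smul, Real.norm_eq_abs,
      abs_of_nonneg (by positivity), ← dist_eq_norm]
    simp
  have h2 : ‖x‖ ^ 2 = dist x c ^ 2 + 2 * inner ℝ (x - c) c + ‖c‖ ^ 2 := by
    have : x = (x - c) + c := by abel
    conv_lhs => rw [this]
    rw [norm_add_sq_real, ← dist_eq_norm]
  rw [h1, h2]
  have hτ : τ = r ^ 2 - 1 - ‖c‖ ^ 2 := by linarith
  subst hτ
  field_simp
  ring

lemma sphereWeight_lt_mirrorWeight {n : ℕ} {c x : Euc n} {r τ s : ℝ} (hr : 0 < r)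
    (hrτ : r ^ 2 = 1 + τ + ‖c‖ ^ 2) (hs : (n : ℝ) / 2 < s) (hx : x ≠ c)
    (hxS : x ∈ sphereSide c r τ) : sphereWeight s x < mirrorWeight c r s x := by
  have h : 0 < τ * (r ^ 2 - dist x c ^ 2) := hxS
  have h' : 0 < τ * (r ^ 2 - dist x c ^ 2) / r ^ 2 := by positivity
  unfold sphereWeight mirrorWeight
  rw [one_add_sq_norm_inversion hr hrτ hx]
  refine (ENNReal.ofReal_lt_ofReal_iff (by positivity)).2 ?_
  exact rpow_lt_rpow (by positivity) (by linarith) (by linarith)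

/-- Two-point symmetrization strictly decreases the weighted `L²` norm of a function that is not
yet symmetrized. -/
lemma lintegral_polarize_sq_lt {n : ℕ} (hn : 1 ≤ n) {c : Euc n} {r τ s : ℝ} (hr : 0 < r)
    (hτ : τ ≠ 0) (hrτ : r ^ 2 = 1 + τ + ‖c‖ ^ 2) (hs : (n : ℝ) / 2 < s) {f : Euc n → ℝ≥0∞}
    (hf : Measurable f) (hfin : ∫⁻ x, f x ^ 2 * sphereWeight s x ≠ ∞)
    (hne : ¬ ∀ᵐ x, x ∈ sphereSide c r τ → kelvin c r s f x ≤ f x) :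
    ∫⁻ x, polarize c r τ s f x ^ 2 * sphereWeight s x < ∫⁻ x, f x ^ 2 * sphereWeight s x := by
  have hS := measurableSet_sphereSide c r τ
  have hW := measurable_sphereWeight (n := n) s
  have hk : Measurable (kelvin c r s f) := measurable_kelvin hf
  have hm (g : Euc n → ℝ≥0∞) (hg : Measurable g) :
      Measurable fun x => g x ^ 2 * sphereWeight s x := (hg.pow_const 2).mul hW
  have hmir : Measurable (mirrorWeight c r s) := by
    have := measurable_inversion c r
    unfold mirrorWeight
    fun_prop
  have hPfold : ∫⁻ x, polarize c r τ s f x ^ 2 * sphereWeight s x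
      = ∫⁻ x in sphereSide c r τ, (max (f x) (kelvin c r s f x) ^ 2 * sphereWeight s x +
          min (f x) (kelvin c r s f x) ^ 2 * mirrorWeight c r s x) := by
    rw [lintegral_eq_sphereSide hn c hr hτ (hm _ (measurable_polarize hf))]
    refine lintegral_congr_ae ?_
    filter_upwards [ae_restrict_of_ae (ae_ne_point hn c), ae_restrict_mem hS] with x hx hxS
    rw [kelvin_sq_mul_sphereWeight hr hx, polarize_of_mem hxS, kelvin_polarize_of_mem hr hx hxS]
  have hfold : ∫⁻ x, f x ^ 2 * sphereWeight s x
      = ∫⁻ x in sphereSide c r τ, (f x ^ 2 * sphereWeight s x +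
          kelvin c r s f x ^ 2 * mirrorWeight c r s x) := by
    rw [lintegral_eq_sphereSide hn c hr hτ (hm _ hf)]
    refine lintegral_congr_ae ?_
    filter_upwards [ae_restrict_of_ae (ae_ne_point hn c)] with x hx
    rw [kelvin_sq_mul_sphereWeight hr hx]
  rw [hfold] at hfin
  have hgm : Measurable fun x => f x ^ 2 * sphereWeight s x +
      kelvin c r s f x ^ 2 * mirrorWeight c r s x := (hm _ hf).add ((hk.pow_const 2).mul hmir)
  have hle : ∀ᵐ x ∂(volume.restrict (sphereSide c r τ)),
      max (f x) (kelvin c r s f x) ^ 2 * sphereWeight s x +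
          min (f x) (kelvin c r s f x) ^ 2 * mirrorWeight c r s x
        ≤ f x ^ 2 * sphereWeight s x + kelvin c r s f x ^ 2 * mirrorWeight c r s x := by
    filter_upwards [ae_restrict_of_ae (ae_ne_point hn c), ae_restrict_mem hS] with x hx hxS
    have hlt := sphereWeight_lt_mirrorWeight hr hrτ hs hx hxS
    rcases le_total (f x) (kelvin c r s f x) with h | h
    · rw [max_eq_right h, min_eq_left h]
      have := mul_add_mul_le_mul_add_mul_ennreal (pow_le_pow_left' h 2) hlt.le
      rw [add_comm]
      exact this.trans_eq (add_comm _ _)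
    · rw [max_eq_left h, min_eq_right h]
  rw [hPfold, hfold]
  refine lintegral_strict_mono_of_ae_le_of_ae_lt_on hgm.aemeasurable
    (ne_top_of_le_ne_top hfin (lintegral_mono_ae hle)) hle
    (s := {x | ¬ kelvin c r s f x ≤ f x}) ?_ ?_
  · intro h0
    refine hne ?_
    have : ∀ᵐ x ∂(volume.restrict (sphereSide c r τ)), kelvin c r s f x ≤ f x :=
      ae_iff.2 h0
    exact (ae_restrict_iff' hS).1 this
  · filter_upwards [ae_restrict_of_ae (ae_ne_point hn c), ae_restrict_mem hS,
      ae_lt_top hgm hfin] with x hx hxS htop hlt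
    replace hlt : f x < kelvin c r s f x := not_le.1 hlt
    have hW := sphereWeight_lt_mirrorWeight hr hrτ hs hx hxS
    rw [max_eq_right hlt.le, min_eq_left hlt.le]
    have hk2 : kelvin c r s f x ^ 2 ≠ ∞ := by
      intro h
      rw [h, ENNReal.top_mul (pos_of_gt hW).ne', add_top] at htop
      exact lt_irrefl _ htop
    have hf2 : f x ^ 2 < kelvin c r s f x ^ 2 := ENNReal.pow_lt_pow_left two_ne_zero hlt
    have hM : mirrorWeight c r s x ≠ ∞ := ENNReal.ofReal_ne_top
    have hWt : sphereWeight s x ≠ ∞ := ENNReal.ofReal_ne_top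
    have hft : f x ^ 2 ≠ ∞ := hf2.ne_top
    generalize f x ^ 2 = a at *
    generalize kelvin c r s f x ^ 2 = b at *
    generalize sphereWeight s x = w at *
    generalize mirrorWeight c r s x = w' at *
    lift a to NNReal using hft
    lift b to NNReal using hk2
    lift w to NNReal using hWt
    lift w' to NNReal using hM
    norm_cast at *
    have h1 : (a : ℝ) < b := by exact_mod_cast hf2
    have h2 : (w : ℝ) < w' := by exact_mod_cast hW
    have : (b * w + a * w' : ℝ) < a * w + b * w' := by nlinarith
    exact_mod_cast this

/-- The penalized norm constraint of the variational problem. -/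
def penalty {n : ℕ} (s : ℝ) (ε : ℝ≥0∞) (f : Euc n → ℝ≥0∞) : ℝ≥0∞ :=
  (∫⁻ x, f x ^ (n / s)) + ε * ∫⁻ x, f x ^ 2 * sphereWeight s x

lemma rieszEnergy_const_mul {n : ℕ} (s : ℝ) {t : ℝ≥0∞} {f : Euc n → ℝ≥0∞} (hf : Measurable f) :
    rieszEnergy s (fun x => t * f x) = t ^ 2 * rieszEnergy s f := by
  have hK (x : Euc n) : Measurable fun y => rieszKernel s x y := by
    unfold rieszKernel
    fun_prop
  have hmeas : Measurable fun z : Euc n × Euc n => f z.1 * f z.2 * rieszKernel s z.1 z.2 :=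
    ((hf.comp measurable_fst).mul (hf.comp measurable_snd)).mul (measurable_rieszKernel s)
  unfold rieszEnergy
  rw [← lintegral_const_mul _ hmeas.lintegral_prod_right']
  refine lintegral_congr fun x => ?_
  have hx : Measurable fun y => f x * f y * rieszKernel s x y := (hf.const_mul _).mul (hK x)
  rw [← lintegral_const_mul _ hx]
  exact lintegral_congr fun y => by ring

lemma penalty_const_mul_le {n : ℕ} (hn : 1 ≤ n) {s : ℝ} (hs : (n : ℝ) / 2 < s) {ε t : ℝ≥0∞}
    (ht : 1 ≤ t) {f : Euc n → ℝ≥0∞} (hf : Measurable f) :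
    penalty s ε (fun x => t * f x) ≤ t ^ 2 * penalty s ε f := by
  have hn' : (0 : ℝ) < n := by exact_mod_cast hn
  have hs0 : 0 < s := by linarith [half_pos hn']
  have hp0 : 0 ≤ n / s := by positivity
  have hp2 : n / s ≤ 2 := by rw [div_le_iff₀ hs0]; linarith
  unfold penalty
  rw [mul_add]
  refine add_le_add ?_ ?_
  · rw [← lintegral_const_mul _ (hf.pow_const _)]
    refine lintegral_mono fun x => ?_
    rw [ENNReal.mul_rpow_of_nonneg _ _ hp0]
    gcongr
    calc t ^ (n / s) ≤ t ^ (2 : ℝ) := ENNReal.rpow_le_rpow_of_exponent_le ht hp2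
      _ = t ^ 2 := by norm_cast
  · have hm : Measurable fun x => f x ^ 2 * sphereWeight s x :=
      (hf.pow_const 2).mul (measurable_sphereWeight s)
    rw [mul_left_comm, ← lintegral_const_mul _ hm]
    refine mul_le_mul_right (lintegral_mono fun x => le_of_eq ?_) ε
    ring

/-- A maximizer of the energy under the penalized constraint dominates its Kelvin transforms. -/
lemma kelvin_le_of_maximizer {n : ℕ} (hn : 1 ≤ n) {s : ℝ} (hs : (n : ℝ) / 2 < s) (hsn : s < n)
    {ε A : ℝ≥0∞} (hε0 : ε ≠ 0) (hA : A ≠ ∞) {f : Euc n → ℝ≥0∞}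
    (hf : Measurable f) (hfA : penalty s ε f ≤ A) (hE0 : rieszEnergy s f ≠ 0)
    (hEt : rieszEnergy s f ≠ ∞)
    (hmax : ∀ g : Euc n → ℝ≥0∞, Measurable g → penalty s ε g ≤ A →
      rieszEnergy s g ≤ rieszEnergy s f)
    {τ : ℝ} (hτ : τ ≠ 0) {c : Euc n} {r : ℝ} (hr : 0 < r) (hrτ : r ^ 2 = 1 + τ + ‖c‖ ^ 2) :
    ∀ᵐ x, x ∈ sphereSide c r τ → kelvin c r s f x ≤ f x := by
  by_contra hne
  have hn' : (0 : ℝ) < n := by exact_mod_cast hn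
  have hs0 : 0 < s := by linarith [half_pos hn']
  have hpen := ne_top_of_le_ne_top hA hfA
  have hW : ∫⁻ x, f x ^ 2 * sphereWeight s x ≠ ∞ := by
    intro h
    unfold penalty at hpen
    rw [h, ENNReal.mul_top hε0, add_top] at hpen
    exact hpen rfl
  have hP := measurable_polarize (c := c) (r := r) (τ := τ) (s := s) hf
  have hlt : penalty s ε (polarize c r τ s f) < A := by
    refine lt_of_lt_of_le ?_ hfA
    unfold penalty
    rw [lintegral_polarize_rpow hn c hr hτ (by positivity) (mul_div_cancel₀ _ hs0.ne') hf]
    have h1 : ∫⁻ x, f x ^ (n / s) ≠ ∞ := ne_top_of_le_ne_top hpen le_self_add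
    by_cases hεt : ε = ∞
    · have h2 : ∫⁻ x, f x ^ 2 * sphereWeight s x = 0 := by
        by_contra h
        unfold penalty at hpen
        rw [hεt, ENNReal.top_mul h, add_top] at hpen
        exact hpen rfl
      exact absurd (lintegral_polarize_sq_lt hn hr hτ hrτ hs hf hW hne) (by simp [h2])
    · refine ENNReal.add_lt_add_left h1 ?_
      exact (ENNReal.mul_lt_mul_iff_right hε0 hεt).2
        (lintegral_polarize_sq_lt hn hr hτ hrτ hs hf hW hne)
  have hA0 : A ≠ 0 := (pos_of_gt hlt).ne'
  set M := max (penalty s ε (polarize c r τ s f)) (A / 2) with hM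
  have hMA : M < A := max_lt hlt (ENNReal.half_lt_self hA0 hA)
  have hM0 : M ≠ 0 := ((ENNReal.half_pos hA0).trans_le (le_max_right _ _)).ne'
  have hMt : M ≠ ∞ := hMA.ne_top
  have ht1 : 1 < A / M := by
    rw [ENNReal.lt_div_iff_mul_lt (Or.inl hM0) (Or.inl hMt), one_mul]
    exact hMA
  set t := (A / M) ^ (1 / 2 : ℝ) with ht
  have ht2 : t ^ 2 = A / M := by
    rw [ht, ← ENNReal.rpow_natCast, ← ENNReal.rpow_mul]
    norm_num
  have ht1' : 1 ≤ t := ENNReal.one_le_rpow ht1.le (by norm_num)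
  have h1 : penalty s ε (fun x => t * polarize c r τ s f x) ≤ A := by
    refine (penalty_const_mul_le hn hs ht1' hP).trans ?_
    rw [ht2]
    calc A / M * penalty s ε (polarize c r τ s f) ≤ A / M * M := by gcongr; exact le_max_left _ _
      _ = A := ENNReal.div_mul_cancel hM0 hMt
  have h2 := hmax _ (hP.const_mul t) h1
  rw [rieszEnergy_const_mul s hP, ht2] at h2
  have h3 : A / M * rieszEnergy s f ≤ 1 * rieszEnergy s f := by
    rw [one_mul]
    refine le_trans ?_ h2
    gcongr
    exact rieszEnergy_le_polarize hn c hr hτ hsn hf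
  exact absurd ((ENNReal.mul_le_mul_iff_left hE0 hEt).1 h3) (not_le.2 ht1)

lemma measurable_kelvin_center {n : ℕ} (s τ : ℝ) {f : Euc n → ℝ≥0∞} (hf : Measurable f) :
    Measurable fun z : Euc n × Euc n => kelvin z.1 (√(1 + τ + ‖z.1‖ ^ 2)) s f z.2 := by
  have h : Measurable fun z : Euc n × Euc n => inversion z.1 (√(1 + τ + ‖z.1‖ ^ 2)) z.2 := by
    unfold EuclideanGeometry.inversion
    simp only [vsub_eq_sub, vadd_eq_add]
    fun_prop
  have hscale : Measurable fun z : Euc n × Euc n =>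
      ENNReal.ofReal ((√(1 + τ + ‖z.1‖ ^ 2) / dist z.2 z.1) ^ (2 * s)) := by fun_prop
  exact hscale.mul (hf.comp h)

/-- Two points of different norm are exchanged by a suitable inversion. -/
lemma exists_center_inversion {n : ℕ} {τ : ℝ} (hτ1 : -1 < τ) {x y : Euc n} (s : ℝ)
    (h : 0 < τ * (‖y‖ ^ 2 - ‖x‖ ^ 2)) (f : Euc n → ℝ≥0∞) :
    ∃ c : Euc n, c ≠ x ∧ x ∈ sphereSide c (√(1 + τ + ‖c‖ ^ 2)) τ ∧
      inversion c (√(1 + τ + ‖c‖ ^ 2)) x = y ∧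
      kelvin c (√(1 + τ + ‖c‖ ^ 2)) s f x
        = ENNReal.ofReal (((1 + τ + ‖y‖ ^ 2) / (1 + τ + ‖x‖ ^ 2)) ^ s) * f y := by
  have hxy : ‖y‖ ^ 2 - ‖x‖ ^ 2 ≠ 0 := right_ne_zero_of_mul h.ne'
  have hne : y - x ≠ 0 := by
    rintro h0
    rw [sub_eq_zero.1 h0] at hxy
    simp at hxy
  have hD : 0 < ‖y - x‖ ^ 2 := by positivity
  set t := -(1 + τ + ‖x‖ ^ 2) / (‖y‖ ^ 2 - ‖x‖ ^ 2) with ht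
  have hx0 : 0 < 1 + τ + ‖x‖ ^ 2 := by nlinarith [sq_nonneg ‖x‖]
  have hy0 : 0 < 1 + τ + ‖y‖ ^ 2 := by nlinarith [sq_nonneg ‖y‖]
  have ht0 : t ≠ 0 := div_ne_zero (neg_ne_zero.2 hx0.ne') hxy
  have htm : t * (‖y‖ ^ 2 - ‖x‖ ^ 2) = -(1 + τ + ‖x‖ ^ 2) := by
    rw [ht]
    field_simp
  have hratio : (t - 1) / t = (1 + τ + ‖y‖ ^ 2) / (1 + τ + ‖x‖ ^ 2) := by
    rw [div_eq_div_iff ht0 hx0.ne']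
    linarith
  set c := x + t • (y - x) with hc
  have hr2 : 1 + τ + ‖c‖ ^ 2 = (t - 1) / t * (t ^ 2 * ‖y - x‖ ^ 2) := by
    have hin : ‖y‖ ^ 2 = ‖x‖ ^ 2 + 2 * inner ℝ x (y - x) + ‖y - x‖ ^ 2 := by
      rw [← norm_add_sq_real]
      simp
    rw [hc, norm_add_sq_real, inner_smul_right, norm_smul, mul_pow, Real.norm_eq_abs, sq_abs]
    field_simp
    rw [hin] at htm
    linarith
  have hr2pos : 0 < 1 + τ + ‖c‖ ^ 2 := by nlinarith [sq_nonneg ‖c‖]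
  have hxc : x - c = (-t) • (y - x) := by
    rw [hc]
    module
  have hdist : dist x c ^ 2 = t ^ 2 * ‖y - x‖ ^ 2 := by
    rw [dist_eq_norm, hxc, norm_smul, mul_pow, Real.norm_eq_abs, sq_abs]
    ring
  have hd : 0 < dist x c := by
    refine lt_of_le_of_ne dist_nonneg fun h0 => ?_
    rw [← h0] at hdist
    have : 0 < t ^ 2 * ‖y - x‖ ^ 2 := by positivity
    rw [← hdist] at this
    simp at this
  have hq : (√(1 + τ + ‖c‖ ^ 2) / dist x c) ^ 2 = (t - 1) / t := by
    rw [div_pow, sq_sqrt hr2pos.le, hdist, hr2]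
    field_simp
  have hinv : inversion c (√(1 + τ + ‖c‖ ^ 2)) x = y := by
    simp only [EuclideanGeometry.inversion, vsub_eq_sub, vadd_eq_add]
    rw [hq, hxc, hc, smul_smul]
    have : (t - 1) / t * -t = 1 - t := by
      field_simp
      ring
    rw [this]
    module
  refine ⟨c, fun h0 => by simp [h0] at hd, ?_, hinv, ?_⟩
  · simp only [sphereSide, Set.mem_ofPred_eq]
    rw [sq_sqrt hr2pos.le, hdist, hr2]
    have h1 : (t - 1) / t * (t ^ 2 * ‖y - x‖ ^ 2) - t ^ 2 * ‖y - x‖ ^ 2 = -t * ‖y - x‖ ^ 2 := by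
      field_simp
      ring
    rw [h1, ← mul_assoc]
    refine mul_pos ?_ hD
    have h2 : τ * -t = (1 + τ + ‖x‖ ^ 2) * (τ * (‖y‖ ^ 2 - ‖x‖ ^ 2)) / (‖y‖ ^ 2 - ‖x‖ ^ 2) ^ 2 := by
      rw [ht]
      field_simp
    rw [h2]
    positivity
  · rw [kelvin, hinv, rpow_mul (by positivity), rpow_two, hq, hratio]

lemma ae_ae_le_of_kelvin_le {n : ℕ} {s : ℝ} {f : Euc n → ℝ≥0∞}
    (hf : Measurable f) {τ : ℝ} (hτ1 : -1 < τ)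
    (hk : ∀ c : Euc n, ∀ᵐ x, x ∈ sphereSide c (√(1 + τ + ‖c‖ ^ 2)) τ →
      kelvin c (√(1 + τ + ‖c‖ ^ 2)) s f x ≤ f x) :
    ∀ᵐ x : Euc n, ∀ᵐ y : Euc n, 0 < τ * (‖y‖ ^ 2 - ‖x‖ ^ 2) →
      ENNReal.ofReal (((1 + τ + ‖y‖ ^ 2) / (1 + τ + ‖x‖ ^ 2)) ^ s) * f y ≤ f x := by
  have hmeas : MeasurableSet {z : Euc n × Euc n |
      z.2 ∈ sphereSide z.1 (√(1 + τ + ‖z.1‖ ^ 2)) τ →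
        kelvin z.1 (√(1 + τ + ‖z.1‖ ^ 2)) s f z.2 ≤ f z.2} := by
    refine MeasurableSet.imp ?_ ?_
    · have h : Measurable fun z : Euc n × Euc n =>
          τ * (√(1 + τ + ‖z.1‖ ^ 2) ^ 2 - dist z.2 z.1 ^ 2) := by fun_prop
      exact measurableSet_lt measurable_const h
    · exact measurableSet_le (measurable_kelvin_center s τ hf) (hf.comp measurable_snd)
  have hswap := (Measure.ae_ae_comm (μ := volume) (ν := volume) (p := fun c x : Euc n =>
    x ∈ sphereSide c (√(1 + τ + ‖c‖ ^ 2)) τ →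
        kelvin c (√(1 + τ + ‖c‖ ^ 2)) s f x ≤ f x) hmeas).1 (Filter.Eventually.of_forall hk)
  filter_upwards [hswap] with x hx
  set N : Set (Euc n) := {c | ¬ (x ∈ sphereSide c (√(1 + τ + ‖c‖ ^ 2)) τ →
        kelvin c (√(1 + τ + ‖c‖ ^ 2)) s f x ≤ f x)} \ {x} with hN
  have hN0 : volume N = 0 := measure_mono_null Set.sdiff_subset (ae_iff.1 hx)
  have hdiff : DifferentiableOn ℝ (fun c : Euc n => inversion c (√(1 + τ + ‖c‖ ^ 2)) x) N := by
    intro c hc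
    have hcx : x - c ≠ 0 := sub_ne_zero.2 fun h => hc.2 h.symm
    have heq : (fun c : Euc n => inversion c (√(1 + τ + ‖c‖ ^ 2)) x)
        = fun c => ((1 + τ + ‖c‖ ^ 2) / ‖x - c‖ ^ 2) • (x - c) + c := by
      funext c
      have : 0 ≤ 1 + τ + ‖c‖ ^ 2 := by nlinarith [sq_nonneg ‖c‖]
      simp only [EuclideanGeometry.inversion, vsub_eq_sub, vadd_eq_add]
      rw [div_pow, sq_sqrt this, dist_eq_norm]
    rw [heq]
    refine DifferentiableAt.differentiableWithinAt ?_
    have h1 : DifferentiableAt ℝ (fun c : Euc n => ‖c‖ ^ 2) c := differentiableAt_id.norm_sq ℝ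
    have h2 : DifferentiableAt ℝ (fun c : Euc n => ‖x - c‖ ^ 2) c :=
      (differentiableAt_id.const_sub x).norm_sq ℝ
    have h3 : ‖x - c‖ ^ 2 ≠ 0 := by positivity
    have h4 : DifferentiableAt ℝ (fun c : Euc n => (1 + τ + ‖c‖ ^ 2) / ‖x - c‖ ^ 2) c := by
      simp only [div_eq_mul_inv]
      exact (h1.const_add (1 + τ)).mul (DifferentiableAt.fun_inv h2 h3)
    exact (h4.smul (differentiableAt_id.const_sub x)).add differentiableAt_id
  have himg := addHaar_image_eq_zero_of_differentiableOn_of_addHaar_eq_zero volume hdiff hN0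
  filter_upwards [measure_eq_zero_iff_ae_notMem.1 himg] with y hy hτy
  by_contra hlt
  obtain ⟨c, hcx, hcS, hinv, hkel⟩ := exists_center_inversion hτ1 s hτy f
  refine hy ⟨c, ⟨?_, hcx⟩, hinv⟩
  simp only [Set.mem_ofPred_eq]
  rw [hkel]
  exact fun h => hlt (h hcS)

lemma ae_ne_norm {n : ℕ} (x : Euc n) (hx : x ≠ 0) :
    ∀ᵐ y : Euc n, ‖y‖ ^ 2 ≠ ‖x‖ ^ 2 := by
  have : volume (Metric.sphere (0 : Euc n) ‖x‖) = 0 :=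
    Measure.addHaar_sphere_of_ne_zero volume _ (norm_ne_zero_iff.2 hx)
  filter_upwards [measure_eq_zero_iff_ae_notMem.1 this] with y hy h
  exact hy (by simpa using (pow_left_inj₀ (norm_nonneg y) (norm_nonneg x) two_ne_zero).1 h)

/-- A function dominating its Kelvin transforms is a multiple of `(1 + |x|²) ^ (-s)`. -/
lemma exists_ae_eq_of_kelvin_le {n : ℕ} (hn : 1 ≤ n) {s : ℝ} {f : Euc n → ℝ≥0∞}
    (hf : Measurable f)
    (hk : ∀ τ : ℝ, τ ≠ 0 → -1 < τ → ∀ c : Euc n,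
      ∀ᵐ x, x ∈ sphereSide c (√(1 + τ + ‖c‖ ^ 2)) τ →
        kelvin c (√(1 + τ + ‖c‖ ^ 2)) s f x ≤ f x) :
    ∃ a : ℝ≥0∞, f =ᵐ[volume] fun x => a * ENNReal.ofReal ((1 + ‖x‖ ^ 2) ^ (-s)) := by
  have hseq (τ : ℕ → ℝ) (h0 : ∀ k, τ k ≠ 0) (h1 : ∀ k, -1 < τ k) :
      ∀ᵐ x : Euc n, ∀ᵐ y : Euc n, ∀ k, 0 < τ k * (‖y‖ ^ 2 - ‖x‖ ^ 2) →
        ENNReal.ofReal (((1 + τ k + ‖y‖ ^ 2) / (1 + τ k + ‖x‖ ^ 2)) ^ s) * f y ≤ f x := by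
    have := ae_all_iff.2 fun k => ae_ae_le_of_kelvin_le hf (h1 k) (hk (τ k) (h0 k) (h1 k))
    filter_upwards [this] with x hx
    exact ae_all_iff.2 hx
  have hlim (τ : ℕ → ℝ) (hτ : Filter.Tendsto τ Filter.atTop (nhds 0)) (x y : Euc n)
      (h : ∀ k, ENNReal.ofReal (((1 + τ k + ‖y‖ ^ 2) / (1 + τ k + ‖x‖ ^ 2)) ^ s) * f y ≤ f x) :
      ENNReal.ofReal (((1 + ‖y‖ ^ 2) / (1 + ‖x‖ ^ 2)) ^ s) * f y ≤ f x := by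
    have hpos : 0 < (1 + ‖y‖ ^ 2) / (1 + ‖x‖ ^ 2) := by positivity
    have hc : Filter.Tendsto (fun k => ((1 + τ k + ‖y‖ ^ 2) / (1 + τ k + ‖x‖ ^ 2)) ^ s)
        Filter.atTop (nhds (((1 + ‖y‖ ^ 2) / (1 + ‖x‖ ^ 2)) ^ s)) := by
      refine Filter.Tendsto.rpow_const ?_ (Or.inl hpos.ne')
      refine Filter.Tendsto.div ?_ ?_ (by positivity)
      · simpa using (hτ.const_add 1).add_const (‖y‖ ^ 2)
      · simpa using (hτ.const_add 1).add_const (‖x‖ ^ 2)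
    refine le_of_tendsto (ENNReal.Tendsto.mul_const (ENNReal.tendsto_ofReal hc) (Or.inl ?_))
      (Filter.Eventually.of_forall h)
    exact (ENNReal.ofReal_pos.2 (rpow_pos_of_pos hpos s)).ne'
  have hτpos (k : ℕ) : 0 < 1 / ((k : ℝ) + 2) := by positivity
  have hτlt (k : ℕ) : 1 / ((k : ℝ) + 2) < 1 := by
    rw [div_lt_one (by positivity)]
    linarith [(Nat.cast_nonneg k : (0 : ℝ) ≤ k)]
  have hτlim : Filter.Tendsto (fun k : ℕ => 1 / ((k : ℝ) + 2)) Filter.atTop (nhds 0) :=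
    tendsto_const_nhds.div_atTop (Filter.tendsto_atTop_add_const_right _ _
      tendsto_natCast_atTop_atTop)
  have hmain : ∀ᵐ x : Euc n, ∀ᵐ y : Euc n,
      ENNReal.ofReal (((1 + ‖y‖ ^ 2) / (1 + ‖x‖ ^ 2)) ^ s) * f y ≤ f x := by
    filter_upwards [hseq _ (fun k => (hτpos k).ne') (fun k => by linarith [hτpos k]),
      hseq (fun k => -(1 / ((k : ℝ) + 2))) (fun k => neg_ne_zero.2 (hτpos k).ne')
        (fun k => by linarith [hτlt k]), ae_ne_point hn 0] with x h1 h2 hx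
    filter_upwards [h1, h2, ae_ne_norm x hx] with y h1 h2 hy
    rcases lt_or_gt_of_ne hy with h | h
    · refine hlim _ (by simpa using hτlim.neg) x y fun k => h2 k ?_
      exact mul_pos_of_neg_of_neg (neg_lt_zero.2 (hτpos k)) (by linarith)
    · exact hlim _ hτlim x y fun k => h1 k (mul_pos (hτpos k) (by linarith))
  have hmeas : MeasurableSet {z : Euc n × Euc n |
      ENNReal.ofReal (((1 + ‖z.2‖ ^ 2) / (1 + ‖z.1‖ ^ 2)) ^ s) * f z.2 ≤ f z.1} :=
    measurableSet_le (by fun_prop) (by fun_prop)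
  have hswap := (Measure.ae_ae_comm (μ := volume) (ν := volume) (p := fun x y : Euc n =>
    ENNReal.ofReal (((1 + ‖y‖ ^ 2) / (1 + ‖x‖ ^ 2)) ^ s) * f y ≤ f x) hmeas).1 hmain
  obtain ⟨x, h1, h2⟩ := (hmain.and hswap).exists
  refine ⟨ENNReal.ofReal ((1 + ‖x‖ ^ 2) ^ s) * f x, ?_⟩
  filter_upwards [h1, h2] with y h1 h2
  have hx : (0 : ℝ) < 1 + ‖x‖ ^ 2 := by positivity
  have hy : (0 : ℝ) < 1 + ‖y‖ ^ 2 := by positivity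
  have e (a b : ℝ) (ha : 0 < a) (hb : 0 < b) :
      ENNReal.ofReal ((a / b) ^ s) = ENNReal.ofReal (a ^ s) * ENNReal.ofReal (b ^ (-s)) := by
    rw [← ENNReal.ofReal_mul (by positivity), div_rpow ha.le hb.le, rpow_neg hb.le, div_eq_mul_inv]
  refine le_antisymm ?_ ?_
  · calc f y = ENNReal.ofReal ((1 + ‖x‖ ^ 2) ^ s) * ENNReal.ofReal ((1 + ‖y‖ ^ 2) ^ (-s)) *
          (ENNReal.ofReal (((1 + ‖y‖ ^ 2) / (1 + ‖x‖ ^ 2)) ^ s) * f y) := by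
          rw [← e _ _ hx hy, ← mul_assoc, ← ENNReal.ofReal_mul (by positivity),
            ← mul_rpow (by positivity) (by positivity)]
          have : (1 + ‖x‖ ^ 2) / (1 + ‖y‖ ^ 2) * ((1 + ‖y‖ ^ 2) / (1 + ‖x‖ ^ 2)) = 1 := by
            field_simp
          simp [this]
      _ ≤ ENNReal.ofReal ((1 + ‖x‖ ^ 2) ^ s) * ENNReal.ofReal ((1 + ‖y‖ ^ 2) ^ (-s)) * f x := by
          gcongr
      _ = _ := by ring
  · rw [e _ _ hx hy] at h2
    exact le_trans (le_of_eq (by ring)) h2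

/-- Bounded sequences of nonnegative functions have weakly convergent subsequences in `L²`. -/
lemma exists_weak_limit {X : Type*} [MeasurableSpace X] [MeasurableSpace.CountablyGenerated X]
    {μ : Measure X} [IsFiniteMeasure μ] {u : ℕ → X → ℝ} (hu : ∀ j, MemLp (u j) 2 μ)
    (hu0 : ∀ j x, 0 ≤ u j x) {R : ℝ≥0∞} (hR : R ≠ ∞) (huR : ∀ j, eLpNorm (u j) 2 μ ≤ R) :
    ∃ v : X → ℝ, Measurable v ∧ (∀ x, 0 ≤ v x) ∧ MemLp v 2 μ ∧ ∃ φ : ℕ → ℕ, StrictMono φ ∧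
      ∀ g : X → ℝ, MemLp g 2 μ → Filter.Tendsto (fun j => ∫ x, u (φ j) x * g x ∂μ) Filter.atTop
        (nhds (∫ x, v x * g x ∂μ)) := by
  have : Fact ((2 : ℝ≥0∞) ≠ ∞) := ⟨by norm_num⟩
  set U : ℕ → Lp ℝ 2 μ := fun j => (hu j).toLp (u j) with hU
  set L : ℕ → WeakDual ℝ (Lp ℝ 2 μ) := fun j =>
    StrongDual.toWeakDual (InnerProductSpace.toDual ℝ (Lp ℝ 2 μ) (U j)) with hL
  have hmem (j : ℕ) : L j ∈ (WeakDual.toStrongDual ⁻¹'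
      Metric.closedBall (0 : StrongDual ℝ (Lp ℝ 2 μ)) R.toReal) := by
    simp only [Set.mem_preimage, mem_closedBall_zero_iff]
    change ‖InnerProductSpace.toDual ℝ (Lp ℝ 2 μ) (U j)‖ ≤ _
    rw [LinearIsometryEquiv.norm_map, hU, Lp.norm_toLp]
    exact ENNReal.toReal_mono hR (huR j)
  obtain ⟨a, -, φ, hφ, hlim⟩ := WeakDual.isSeqCompact_closedBall ℝ (Lp ℝ 2 μ) 0 R.toReal hmem
  set V : Lp ℝ 2 μ := (InnerProductSpace.toDual ℝ (Lp ℝ 2 μ)).symm (WeakDual.toStrongDual a)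
    with hV
  have hVm := Lp.memLp V
  have hweak (g : X → ℝ) (hg : MemLp g 2 μ) :
      Filter.Tendsto (fun j => ∫ x, u (φ j) x * g x ∂μ) Filter.atTop
        (nhds (∫ x, V x * g x ∂μ)) := by
    have h := (tendsto_iff_forall_eval_tendsto_topDualPairing.1 hlim) (hg.toLp g)
    have h1 (w : Lp ℝ 2 μ) : inner ℝ w (hg.toLp g) = ∫ x, w x * g x ∂μ := by
      rw [L2.inner_def]
      refine integral_congr_ae ?_
      filter_upwards [hg.coeFn_toLp] with x hx
      rw [hx]
      simp [mul_comm]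
    have h2 (j : ℕ) : topDualPairing ℝ (Lp ℝ 2 μ) (L (φ j)) (hg.toLp g)
        = ∫ x, u (φ j) x * g x ∂μ := by
      have : topDualPairing ℝ (Lp ℝ 2 μ) (L (φ j)) (hg.toLp g)
          = inner ℝ (U (φ j)) (hg.toLp g) := InnerProductSpace.toDual_apply_apply (𝕜 := ℝ)
      rw [this, h1]
      refine integral_congr_ae ?_
      filter_upwards [(hu (φ j)).coeFn_toLp] with x hx
      rw [hU]
      simp only
      rw [hx]
    have h3 : topDualPairing ℝ (Lp ℝ 2 μ) a (hg.toLp g) = ∫ x, V x * g x ∂μ := by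
      rw [← h1, hV, InnerProductSpace.toDual_symm_apply]
      rfl
    rw [h3] at h
    exact h.congr h2
  have hV0 : 0 ≤ᵐ[μ] V := by
    refine ae_nonneg_of_forall_setIntegral_nonneg (hVm.integrable (by norm_num)) fun s hs _ => ?_
    have hg : MemLp (s.indicator fun _ => (1 : ℝ)) 2 μ :=
      memLp_indicator_const 2 hs 1 (Or.inr (measure_ne_top μ s))
    have h := hweak _ hg
    have h' (w : X → ℝ) : ∫ x, w x * s.indicator (fun _ => (1 : ℝ)) x ∂μ = ∫ x in s, w x ∂μ := by
      rw [← integral_indicator hs]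
      congr 1
      ext x
      by_cases hx : x ∈ s <;> simp [hx]
    simp only [h'] at h
    exact ge_of_tendsto' h fun j => integral_nonneg fun x => hu0 _ x
  have hae : V =ᵐ[μ] fun x => max (V x) 0 := by
    filter_upwards [hV0] with x hx
    exact (max_eq_left hx).symm
  refine ⟨fun x => max (V x) 0, (Lp.stronglyMeasurable V).measurable.max measurable_const,
    fun x => le_max_right _ _, hVm.ae_eq hae, φ, hφ, fun g hg => ?_⟩
  have he : ∫ x, V x * g x ∂μ = ∫ x, max (V x) 0 * g x ∂μ :=
    integral_congr_ae (hae.mul (Filter.EventuallyEq.refl _ g))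
  rw [← he]
  exact hweak g hg

lemma rpow_tangent_le {p a t : ℝ} (hp : 1 < p) (ha : 0 ≤ a) (ht : 0 ≤ t) :
    a ^ p + p * a ^ (p - 1) * (t - a) ≤ t ^ p := by
  rcases ha.eq_or_lt with rfl | ha
  · rw [zero_rpow (by linarith), zero_rpow (by linarith)]
    simpa using rpow_nonneg ht p
  · have h := one_add_mul_self_le_rpow_one_add (s := t / a - 1) (p := p)
      (by linarith [div_nonneg ht ha.le]) hp.le
    rw [add_sub_cancel, div_rpow ht ha.le, le_div_iff₀ (rpow_pos_of_pos ha p)] at h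
    refine le_trans (le_of_eq ?_) h
    rw [rpow_sub_one ha.ne']
    field_simp

lemma rpow_le_one_add_rpow {a p q : ℝ} (ha : 0 ≤ a) (hp : 0 ≤ p) (hpq : p ≤ q) :
    a ^ p ≤ 1 + a ^ q := by
  have hq := rpow_nonneg ha q
  rcases le_total a 1 with h | h
  · linarith [rpow_le_one ha h hp]
  · linarith [rpow_le_rpow_of_exponent_le h hpq]

lemma integrable_rpow_of_memLp_two {X : Type*} [MeasurableSpace X] {μ : Measure X}
    [IsFiniteMeasure μ] {v : X → ℝ} (hv0 : ∀ x, 0 ≤ v x) (hv : MemLp v 2 μ) {p : ℝ} (hp : 0 ≤ p)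
    (hp2 : p ≤ 2) : Integrable (fun x => v x ^ p) μ := by
  refine Integrable.mono' ((integrable_const (1 : ℝ)).add hv.integrable_sq)
    (hv.1.aemeasurable.pow_const p).aestronglyMeasurable (Filter.Eventually.of_forall fun x => ?_)
  rw [Real.norm_of_nonneg (rpow_nonneg (hv0 x) p)]
  simpa using rpow_le_one_add_rpow (hv0 x) hp hp2

/-- The penalized norm is weakly lower semicontinuous. -/
lemma integral_penalty_le_of_weak {X : Type*} [MeasurableSpace X] {μ : Measure X}
    [IsFiniteMeasure μ] {u : ℕ → X → ℝ} (hu : ∀ j, MemLp (u j) 2 μ) (hu0 : ∀ j x, 0 ≤ u j x)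
    {v : X → ℝ} (hv : MemLp v 2 μ) (hv0 : ∀ x, 0 ≤ v x)
    (hweak : ∀ g : X → ℝ, MemLp g 2 μ → Filter.Tendsto (fun j => ∫ x, u j x * g x ∂μ) Filter.atTop
        (nhds (∫ x, v x * g x ∂μ)))
    {p ε A : ℝ} (hp : 1 < p) (hp2 : p ≤ 2) (hε : 0 ≤ ε)
    (hA : ∀ j, ∫ x, (u j x ^ p + ε * u j x ^ 2) ∂μ ≤ A) :
    ∫ x, (v x ^ p + ε * v x ^ 2) ∂μ ≤ A := by
  have hI (w : X → ℝ) (hw : MemLp w 2 μ) (hw0 : ∀ x, 0 ≤ w x) :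
      Integrable (fun x => w x ^ p + ε * w x ^ 2) μ :=
    (integrable_rpow_of_memLp_two hw0 hw (by linarith) hp2).add (hw.integrable_sq.const_mul ε)
  set g : X → ℝ := fun x => p * v x ^ (p - 1) + 2 * ε * v x with hg
  have hgm : MemLp g 2 μ := by
    refine MemLp.add (MemLp.const_mul ?_ p) (hv.const_mul (2 * ε))
    refine ((memLp_const (1 : ℝ)).add hv).mono'
      (hv.1.aemeasurable.pow_const _).aestronglyMeasurable (Filter.Eventually.of_forall fun x => ?_)
    rw [Real.norm_of_nonneg (rpow_nonneg (hv0 x) _)]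
    simpa using rpow_le_one_add_rpow (q := 1) (hv0 x) (by linarith : 0 ≤ p - 1) (by linarith)
  have hle (j : ℕ) : ∫ x, (v x ^ p + ε * v x ^ 2) ∂μ + (∫ x, u j x * g x ∂μ - ∫ x, v x * g x ∂μ)
      ≤ A := by
    refine le_trans ?_ (hA j)
    have i1 : Integrable (fun x => u j x * g x) μ := (hu j).integrable_mul hgm
    have i2 : Integrable (fun x => v x * g x) μ := hv.integrable_mul hgm
    have i3 := hI v hv hv0
    have i4 : Integrable (fun x => u j x * g x - v x * g x) μ := i1.sub i2
    rw [← integral_sub i1 i2, ← integral_add i3 i4]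
    refine integral_mono (i3.add i4) (hI _ (hu j) (hu0 j)) fun x => ?_
    have h1 := rpow_tangent_le hp (hv0 x) (hu0 j x)
    have h2 : 0 ≤ ε * (u j x - v x) ^ 2 := by positivity
    simp only [hg]
    nlinarith
  have hlim : Filter.Tendsto (fun j => ∫ x, (v x ^ p + ε * v x ^ 2) ∂μ +
      (∫ x, u j x * g x ∂μ - ∫ x, v x * g x ∂μ)) Filter.atTop
      (nhds (∫ x, (v x ^ p + ε * v x ^ 2) ∂μ)) := by
    simpa using ((hweak g hgm).sub_const (∫ x, v x * g x ∂μ)).const_add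
      (∫ x, (v x ^ p + ε * v x ^ 2) ∂μ)
  exact le_of_tendsto' hlim hle

/-- Quadratic forms with bounded kernels are weakly continuous on bounded sets. -/
lemma tendsto_integral_bounded_kernel {X : Type*} [MeasurableSpace X] {μ : Measure X}
    [IsFiniteMeasure μ] {u : ℕ → X → ℝ} (hu : ∀ j, MemLp (u j) 2 μ) (hu0 : ∀ j x, 0 ≤ u j x)
    (hum : ∀ j, Measurable (u j)) {B : ℝ} (hB : ∀ j, ∫ x, u j x ^ 2 ∂μ ≤ B)
    {v : X → ℝ} (hv : MemLp v 2 μ) (hvm : Measurable v)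
    (hweak : ∀ g : X → ℝ, MemLp g 2 μ → Filter.Tendsto (fun j => ∫ x, u j x * g x ∂μ) Filter.atTop
        (nhds (∫ x, v x * g x ∂μ)))
    {κ : X → X → ℝ} (hκ : Measurable fun z : X × X => κ z.1 z.2) {M : ℝ}
    (hκ0 : ∀ x y, 0 ≤ κ x y) (hκM : ∀ x y, κ x y ≤ M) :
    Filter.Tendsto (fun j => ∫ x, u j x * ∫ y, u j y * κ x y ∂μ ∂μ) Filter.atTop
      (nhds (∫ x, v x * ∫ y, v y * κ x y ∂μ ∂μ)) := by
  have hκx (x : X) : MemLp (κ x) 2 μ :=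
    MemLp.of_bound (hκ.comp measurable_prodMk_left).aestronglyMeasurable M
      (Filter.Eventually.of_forall fun y => by
        rw [Real.norm_of_nonneg (hκ0 x y)]
        exact hκM x y)
  have hTm (w : X → ℝ) (hw : Measurable w) : Measurable fun x => ∫ y, w y * κ x y ∂μ := by
    have : StronglyMeasurable fun z : X × X => w z.2 * κ z.1 z.2 :=
      ((hw.comp measurable_snd).mul hκ).stronglyMeasurable
    exact this.integral_prod_right'.measurable
  have hTb (w : X → ℝ) (hw : MemLp w 2 μ) (x : X) :
      |∫ y, w y * κ x y ∂μ| ≤ M * (μ.real Set.univ + ∫ y, w y ^ 2 ∂μ) := by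
    have i1 : Integrable (fun y => M * (1 + w y ^ 2)) μ :=
      ((integrable_const (1 : ℝ)).add hw.integrable_sq).const_mul M
    have h := norm_integral_le_of_norm_le (f := fun y => w y * κ x y) i1
      (Filter.Eventually.of_forall fun y => by
        rw [norm_mul, Real.norm_of_nonneg (hκ0 x y), mul_comm]
        have h1 : ‖w y‖ ≤ 1 + w y ^ 2 := by
          rw [Real.norm_eq_abs]
          nlinarith [sq_abs (w y), sq_nonneg (|w y| - 1), abs_nonneg (w y)]
        exact mul_le_mul (hκM x y) h1 (norm_nonneg _) ((hκ0 x y).trans (hκM x y)))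
    rw [Real.norm_eq_abs, integral_const_mul, integral_add (integrable_const _) hw.integrable_sq]
      at h
    simpa using h
  rcases isEmpty_or_nonempty X with hX | ⟨⟨x₀⟩⟩
  · simp [Measure.eq_zero_of_isEmpty μ]
  have hM0 : 0 ≤ M := (hκ0 x₀ x₀).trans (hκM x₀ x₀)
  set Tv : X → ℝ := fun x => ∫ y, v y * κ x y ∂μ with hTv
  have hTvL : MemLp Tv 2 μ := MemLp.of_bound (hTm v hvm).aestronglyMeasurable _
    (Filter.Eventually.of_forall fun x => hTb v hv x)
  set D : ℝ := M * (μ.real Set.univ + B) + M * (μ.real Set.univ + ∫ y, v y ^ 2 ∂μ) with hD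
  set d : ℕ → X → ℝ := fun j x => |(∫ y, u j y * κ x y ∂μ) - Tv x| with hd
  have hdm (j : ℕ) : Measurable (d j) := ((hTm _ (hum j)).sub (hTm v hvm)).abs
  have hd0 (j : ℕ) (x : X) : 0 ≤ d j x := abs_nonneg _
  have hdD (j : ℕ) (x : X) : d j x ≤ D := by
    refine (abs_sub _ _).trans (add_le_add ((hTb _ (hu j) x).trans ?_) (hTb v hv x))
    gcongr
    exact hB j
  have hdL (j : ℕ) : MemLp (d j) 2 μ := MemLp.of_bound (hdm j).aestronglyMeasurable D
    (Filter.Eventually.of_forall fun x => by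
      rw [Real.norm_of_nonneg (hd0 j x)]
      exact hdD j x)
  have hdlim : Filter.Tendsto (fun j => ∫ x, d j x ^ 2 ∂μ) Filter.atTop (nhds 0) := by
    have h := tendsto_integral_of_dominated_convergence (μ := μ) (F := fun j x => d j x ^ 2)
      (f := fun _ => (0 : ℝ)) (fun _ => D ^ 2)
      (fun j => ((hdm j).pow_const 2).aestronglyMeasurable) (integrable_const _)
      (fun j => Filter.Eventually.of_forall fun x => by
        rw [Real.norm_of_nonneg (by positivity)]
        exact pow_le_pow_left₀ (hd0 j x) (hdD j x) 2)
      (Filter.Eventually.of_forall fun x => by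
        have h1 := (hweak (κ x) (hκx x)).sub_const (Tv x)
        rw [hTv, sub_self] at h1
        simpa [hd] using (h1.abs.pow 2))
    simpa using h
  have hsqrt : Filter.Tendsto (fun j => √B * √(∫ x, d j x ^ 2 ∂μ)) Filter.atTop (nhds 0) := by
    simpa using (hdlim.sqrt).const_mul √B
  have herr (j : ℕ) : ‖∫ x, u j x * ((∫ y, u j y * κ x y ∂μ) - Tv x) ∂μ‖
      ≤ √B * √(∫ x, d j x ^ 2 ∂μ) := by
    have hH := integral_mul_le_Lp_mul_Lq_of_nonneg (μ := μ) (Real.HolderConjugate.two_two)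
      (Filter.Eventually.of_forall (hu0 j)) (Filter.Eventually.of_forall (hd0 j))
      (by simpa using hu j) (by simpa using hdL j)
    have h1 : ‖∫ x, u j x * ((∫ y, u j y * κ x y ∂μ) - Tv x) ∂μ‖ ≤ ∫ x, u j x * d j x ∂μ := by
      refine norm_integral_le_of_norm_le ((hu j).integrable_mul (hdL j))
        (Filter.Eventually.of_forall fun x => ?_)
      simp [hd, abs_of_nonneg (hu0 j x)]
    refine h1.trans (hH.trans ?_)
    simp only [rpow_two, ← sqrt_eq_rpow]
    gcongr
    exact hB j
  have hfirst := hweak Tv hTvL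
  have hsum := hfirst.add (squeeze_zero_norm herr hsqrt)
  rw [add_zero] at hsum
  refine hsum.congr fun j => ?_
  have i1 : Integrable (fun x => u j x * Tv x) μ := (hu j).integrable_mul hTvL
  have hTuL : MemLp (fun x => ∫ y, u j y * κ x y ∂μ) 2 μ :=
    MemLp.of_bound (hTm _ (hum j)).aestronglyMeasurable _
      (Filter.Eventually.of_forall fun x => hTb _ (hu j) x)
  have i2 : Integrable (fun x => u j x * ((∫ y, u j y * κ x y ∂μ) - Tv x)) μ :=
    (hu j).integrable_mul (hTuL.sub hTvL)
  rw [← integral_add i1 i2]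
  congr 1
  ext x
  ring

lemma ENNReal.mul_le_sq_add_sq (a b : ℝ≥0∞) : a * b ≤ a ^ 2 + b ^ 2 := by
  rcases le_total a b with h | h
  · calc a * b ≤ b * b := by gcongr
      _ ≤ a ^ 2 + b ^ 2 := by rw [← sq]; exact le_add_self
  · calc a * b ≤ a * a := by gcongr
      _ ≤ a ^ 2 + b ^ 2 := by rw [← sq]; exact le_self_add

/-- The Schur test for nonnegative symmetric kernels. -/
lemma lintegral_kernel_le {X : Type*} [MeasurableSpace X] {μ : Measure X} [SFinite μ]
    {l : X → X → ℝ≥0∞} (hl : Measurable fun z : X × X => l z.1 z.2)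
    (hsymm : ∀ x y, l x y = l y x) {C : ℝ≥0∞} (hC : ∀ x, ∫⁻ y, l x y ∂μ ≤ C)
    {F : X → ℝ≥0∞} (hF : Measurable F) :
    ∫⁻ x, ∫⁻ y, F x * F y * l x y ∂μ ∂μ ≤ 2 * C * ∫⁻ x, F x ^ 2 ∂μ := by
  have hlx (x : X) : Measurable (l x) := hl.comp measurable_prodMk_left
  have h1 : ∫⁻ x, ∫⁻ y, F x ^ 2 * l x y ∂μ ∂μ ≤ C * ∫⁻ x, F x ^ 2 ∂μ := by
    rw [← lintegral_const_mul _ (hF.pow_const 2)]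
    refine lintegral_mono fun x => ?_
    rw [lintegral_const_mul _ (hlx x), mul_comm]
    gcongr
    exact hC x
  have h2 : ∫⁻ x, ∫⁻ y, F y ^ 2 * l x y ∂μ ∂μ ≤ C * ∫⁻ x, F x ^ 2 ∂μ := by
    rw [lintegral_lintegral_swap
      (((hF.comp measurable_snd).pow_const 2).mul hl).aemeasurable]
    refine le_trans (le_of_eq ?_) h1
    simp only [hsymm]
  calc ∫⁻ x, ∫⁻ y, F x * F y * l x y ∂μ ∂μ
      ≤ ∫⁻ x, ∫⁻ y, (F x ^ 2 * l x y + F y ^ 2 * l x y) ∂μ ∂μ := by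
        refine lintegral_mono fun x => lintegral_mono fun y => ?_
        rw [← add_mul]
        gcongr
        exact ENNReal.mul_le_sq_add_sq _ _
    _ = ∫⁻ x, ∫⁻ y, F x ^ 2 * l x y ∂μ ∂μ + ∫⁻ x, ∫⁻ y, F y ^ 2 * l x y ∂μ ∂μ := by
        have hm : Measurable fun z : X × X => F z.1 ^ 2 * l z.1 z.2 :=
          ((hF.comp measurable_fst).pow_const 2).mul hl
        rw [← lintegral_add_left hm.lintegral_prod_right']
        exact lintegral_congr fun x => lintegral_add_left ((hlx x).const_mul _) _
    _ ≤ C * ∫⁻ x, F x ^ 2 ∂μ + C * ∫⁻ x, F x ^ 2 ∂μ := add_le_add h1 h2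
    _ = _ := by ring

lemma ENNReal.le_min_add_rpow {δ : ℝ} (hδ : 0 < δ) {M : ℝ≥0∞} (hM0 : M ≠ 0) (hM : M ≠ ∞)
    (k : ℝ≥0∞) : k ≤ min k M + M ^ (-δ) * k ^ (1 + δ) := by
  rcases le_total k M with h | h
  · rw [min_eq_left h]
    exact le_self_add
  · refine le_add_of_le_right ?_
    have hM' : M ^ (-δ) ≠ 0 := by simp [hM, hM0]
    by_cases hk : k = ∞
    · rw [hk, ENNReal.top_rpow_of_pos (by linarith), ENNReal.mul_top hM']
    · have hk0 : k ≠ 0 := fun h0 => hM0 (by simpa [h0] using h)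
      calc k = k ^ (-δ) * k ^ (1 + δ) := by
            rw [← ENNReal.rpow_add _ _ hk0 hk]
            simp
        _ ≤ M ^ (-δ) * k ^ (1 + δ) := by
            gcongr ?_ * _
            rw [ENNReal.rpow_neg, ENNReal.rpow_neg]
            exact ENNReal.inv_le_inv.2 (ENNReal.rpow_le_rpow h hδ.le)

lemma lintegral_penalty_eq_ofReal {X : Type*} [MeasurableSpace X] {μ : Measure X}
    [IsFiniteMeasure μ] {w : X → ℝ} (hw : MemLp w 2 μ) (hw0 : ∀ x, 0 ≤ w x) (hwm : Measurable w)
    {p ε : ℝ} (hp : 0 ≤ p) (hp2 : p ≤ 2) (hε : 0 ≤ ε) :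
    ∫⁻ x, ENNReal.ofReal (w x) ^ p ∂μ + ENNReal.ofReal ε * ∫⁻ x, ENNReal.ofReal (w x) ^ 2 ∂μ
      = ENNReal.ofReal (∫ x, (w x ^ p + ε * w x ^ 2) ∂μ) := by
  have i : Integrable (fun x => w x ^ p + ε * w x ^ 2) μ :=
    (integrable_rpow_of_memLp_two hw0 hw hp hp2).add (hw.integrable_sq.const_mul ε)
  have hnn (x : X) : 0 ≤ w x ^ p := rpow_nonneg (hw0 x) p
  rw [ofReal_integral_eq_lintegral_ofReal i
    (Filter.Eventually.of_forall fun x => add_nonneg (hnn x) (by positivity)),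
    ← lintegral_const_mul _ (by fun_prop), ← lintegral_add_left (by fun_prop)]
  refine lintegral_congr fun x => ?_
  rw [ENNReal.ofReal_add (hnn x) (by positivity), ENNReal.ofReal_mul hε,
    ENNReal.ofReal_pow (hw0 x), ENNReal.ofReal_rpow_of_nonneg (hw0 x) hp]

lemma lintegral_bounded_kernel_eq_ofReal {X : Type*} [MeasurableSpace X] {μ : Measure X}
    [IsFiniteMeasure μ] {w : X → ℝ} (hw : MemLp w 2 μ) (hw0 : ∀ x, 0 ≤ w x) (hwm : Measurable w)
    {κ : X → X → ℝ} (hκ : Measurable fun z : X × X => κ z.1 z.2) {M : ℝ}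
    (hκ0 : ∀ x y, 0 ≤ κ x y) (hκM : ∀ x y, κ x y ≤ M) :
    ∫⁻ x, ∫⁻ y, ENNReal.ofReal (w x) * ENNReal.ofReal (w y) * ENNReal.ofReal (κ x y) ∂μ ∂μ
      = ENNReal.ofReal (∫ x, w x * ∫ y, w y * κ x y ∂μ ∂μ) := by
  have hκx (x : X) : Measurable (κ x) := hκ.comp measurable_prodMk_left
  have hwI : Integrable w μ := hw.integrable (by norm_num)
  have hin (x : X) : Integrable (fun y => w y * κ x y) μ :=
    hwI.mul_bdd (c := M) (hκx x).aestronglyMeasurable (Filter.Eventually.of_forall fun y => by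
      rw [Real.norm_of_nonneg (hκ0 x y)]
      exact hκM x y)
  have hin0 (x : X) : 0 ≤ ∫ y, w y * κ x y ∂μ :=
    integral_nonneg fun y => mul_nonneg (hw0 y) (hκ0 x y)
  have hTm : Measurable fun x => ∫ y, w y * κ x y ∂μ := by
    have : StronglyMeasurable fun z : X × X => w z.2 * κ z.1 z.2 :=
      ((hwm.comp measurable_snd).mul hκ).stronglyMeasurable
    exact this.integral_prod_right'.measurable
  have hout : Integrable (fun x => w x * ∫ y, w y * κ x y ∂μ) μ := by
    refine hwI.mul_bdd (c := ∫ y, w y * M ∂μ) hTm.aestronglyMeasurable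
      (Filter.Eventually.of_forall fun x => ?_)
    rw [Real.norm_of_nonneg (hin0 x)]
    exact integral_mono (hin x) (hwI.mul_const M)
      fun y => mul_le_mul_of_nonneg_left (hκM x y) (hw0 y)
  rw [ofReal_integral_eq_lintegral_ofReal hout
    (Filter.Eventually.of_forall fun x => mul_nonneg (hw0 x) (hin0 x))]
  refine lintegral_congr fun x => ?_
  rw [ENNReal.ofReal_mul (hw0 x), ofReal_integral_eq_lintegral_ofReal (hin x)
    (Filter.Eventually.of_forall fun y => mul_nonneg (hw0 y) (hκ0 x y)),
    ← lintegral_const_mul' _ _ ENNReal.ofReal_ne_top]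
  refine lintegral_congr fun y => ?_
  rw [ENNReal.ofReal_mul (hw0 y), mul_assoc]

/-- The penalized variational problem for a kernel with uniformly bounded `L^(1+δ)` norms has a
maximizer. -/
lemma exists_maximizer {X : Type*} [MeasurableSpace X] [MeasurableSpace.CountablyGenerated X]
    {μ : Measure X} [IsFiniteMeasure μ] {k : X → X → ℝ≥0∞}
    (hk : Measurable fun z : X × X => k z.1 z.2) (hsymm : ∀ x y, k x y = k y x) {δ : ℝ}
    (hδ : 0 < δ) {C : ℝ≥0∞} (hC : C ≠ ∞) (hkC : ∀ x, ∫⁻ y, k x y ^ (1 + δ) ∂μ ≤ C)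
    {p : ℝ} (hp : 1 < p) (hp2 : p ≤ 2) {ε : ℝ} (hε : 0 < ε) {A : ℝ≥0∞} (hA : A ≠ ∞) :
    ∃ F : X → ℝ≥0∞, Measurable F ∧
      ∫⁻ x, F x ^ p ∂μ + ENNReal.ofReal ε * ∫⁻ x, F x ^ 2 ∂μ ≤ A ∧
      ∀ G : X → ℝ≥0∞, Measurable G →
        ∫⁻ x, G x ^ p ∂μ + ENNReal.ofReal ε * ∫⁻ x, G x ^ 2 ∂μ ≤ A →
        ∫⁻ x, ∫⁻ y, G x * G y * k x y ∂μ ∂μ ≤ ∫⁻ x, ∫⁻ y, F x * F y * k x y ∂μ ∂μ := by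
  have hp0 : 0 ≤ p := by linarith
  have hε' : ENNReal.ofReal ε ≠ 0 := (ENNReal.ofReal_pos.2 hε).ne'
  set N : (X → ℝ≥0∞) → ℝ≥0∞ := fun F =>
    ∫⁻ x, F x ^ p ∂μ + ENNReal.ofReal ε * ∫⁻ x, F x ^ 2 ∂μ with hN
  set I : (X → ℝ≥0∞) → ℝ≥0∞ := fun F => ∫⁻ x, ∫⁻ y, F x * F y * k x y ∂μ ∂μ with hI
  set S : Set ℝ≥0∞ := {e | ∃ G, Measurable G ∧ N G ≤ A ∧ I G = e} with hS
  have hSne : S.Nonempty := by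
    refine ⟨I 0, 0, measurable_zero, ?_, rfl⟩
    simp [hN, ENNReal.zero_rpow_of_pos (lt_trans one_pos hp)]
  obtain ⟨e, -, helim, heS⟩ := exists_seq_tendsto_sSup hSne (OrderTop.bddAbove S)
  choose G hGm hGA hGe using heS
  set R : ℝ≥0∞ := A / ENNReal.ofReal ε with hR
  have hRt : R ≠ ∞ := ENNReal.div_ne_top hA hε'
  have hsq {F : X → ℝ≥0∞} (hF : N F ≤ A) : ∫⁻ x, F x ^ 2 ∂μ ≤ R := by
    rw [hR, ENNReal.le_div_iff_mul_le (Or.inl hε') (Or.inl ENNReal.ofReal_ne_top), mul_comm]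
    exact le_add_self.trans hF
  set u : ℕ → X → ℝ := fun j x => (G j x).toReal with hu
  have hum (j : ℕ) : Measurable (u j) := (hGm j).ennreal_toReal
  have hu0 (j : ℕ) (x : X) : 0 ≤ u j x := ENNReal.toReal_nonneg
  have huG (j : ℕ) : (fun x => ENNReal.ofReal (u j x)) =ᵐ[μ] G j := by
    have h := ae_lt_top ((hGm j).pow_const 2) (ne_top_of_le_ne_top hRt (hsq (hGA j)))
    filter_upwards [h] with x hx
    exact ENNReal.ofReal_toReal fun h => by simp [h] at hx
  have hu2 (j : ℕ) : eLpNorm (u j) 2 μ ≤ R ^ (1 / 2 : ℝ) := by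
    rw [eLpNorm_eq_lintegral_rpow_enorm_toReal (by norm_num) (by norm_num)]
    have h2 : (2 : ℝ≥0∞).toReal = 2 := by norm_num
    rw [h2]
    refine ENNReal.rpow_le_rpow (le_trans (le_of_eq ?_) (hsq (hGA j))) (by norm_num)
    refine lintegral_congr_ae ?_
    filter_upwards [huG j] with x hx
    rw [← hx, Real.enorm_eq_ofReal (hu0 j x)]
    norm_cast
  have huL (j : ℕ) : MemLp (u j) 2 μ := ⟨(hum j).aestronglyMeasurable,
    (hu2 j).trans_lt (ENNReal.rpow_lt_top_of_nonneg (by norm_num) hRt)⟩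
  have hNu (j : ℕ) : ENNReal.ofReal (∫ x, (u j x ^ p + ε * u j x ^ 2) ∂μ) ≤ A := by
    rw [← lintegral_penalty_eq_ofReal (huL j) (hu0 j) (hum j) hp0 hp2 hε.le]
    refine le_trans (le_of_eq ?_) (hGA j)
    simp only [hN]
    congr 1
    · exact lintegral_congr_ae ((huG j).mono fun x hx => by simp only [hx])
    · congr 1
      exact lintegral_congr_ae ((huG j).mono fun x hx => by simp only [hx])
  obtain ⟨v, hvm, hv0, hvL, φ, hφ, hweak⟩ := exists_weak_limit huL hu0
    (ENNReal.rpow_ne_top_of_nonneg (by norm_num) hRt) hu2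
  have hNv : N (fun x => ENNReal.ofReal (v x)) ≤ A := by
    simp only [hN]
    rw [lintegral_penalty_eq_ofReal hvL hv0 hvm hp0 hp2 hε.le]
    refine ENNReal.ofReal_le_of_le_toReal ?_
    exact integral_penalty_le_of_weak (fun j => huL (φ j)) (fun j => hu0 (φ j)) hvL hv0 hweak hp hp2
      hε.le fun j => (ENNReal.ofReal_le_iff_le_toReal hA).1 (hNu (φ j))
  have hB (j : ℕ) : ∫ x, u j x ^ 2 ∂μ ≤ R.toReal := by
    refine (ENNReal.ofReal_le_iff_le_toReal hRt).1 ?_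
    rw [ofReal_integral_eq_lintegral_ofReal (huL j).integrable_sq
      (Filter.Eventually.of_forall fun x => by positivity)]
    refine le_trans (le_of_eq ?_) (hsq (hGA j))
    exact lintegral_congr_ae ((huG j).mono fun x hx => by
      simp only
      rw [← hx, ENNReal.ofReal_pow (hu0 j x)])
  have hbound (M : ℕ) : sSup S ≤ I (fun x => ENNReal.ofReal (v x)) +
      ((M + 1 : ℕ) : ℝ≥0∞) ^ (-δ) * (2 * C * R) := by
    set m : ℝ≥0∞ := ((M + 1 : ℕ) : ℝ≥0∞) with hm
    have hm0 : m ≠ 0 := by simp [hm]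
    have hmt : m ≠ ∞ := ENNReal.natCast_ne_top _
    set κ : X → X → ℝ := fun x y => (min (k x y) m).toReal with hκ
    have hκt (x y : X) : min (k x y) m ≠ ∞ := ne_top_of_le_ne_top hmt (min_le_right _ _)
    have hκm : Measurable fun z : X × X => κ z.1 z.2 := (hk.min measurable_const).ennreal_toReal
    have hκe (x y : X) : ENNReal.ofReal (κ x y) = min (k x y) m := ENNReal.ofReal_toReal (hκt x y)
    have hκ0 (x y : X) : 0 ≤ κ x y := ENNReal.toReal_nonneg
    have hκM (x y : X) : κ x y ≤ m.toReal := ENNReal.toReal_mono hmt (min_le_right _ _)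
    have hlim := tendsto_integral_bounded_kernel (fun j => huL (φ j)) (fun j => hu0 (φ j))
      (fun j => hum (φ j)) (fun j => hB (φ j)) hvL hvm hweak hκm hκ0 hκM
    have hlim' := (ENNReal.tendsto_ofReal hlim).add_const (m ^ (-δ) * (2 * C * R))
    simp only [← lintegral_bounded_kernel_eq_ofReal (huL _) (hu0 _) (hum _) hκm hκ0 hκM] at hlim'
    rw [← lintegral_bounded_kernel_eq_ofReal hvL hv0 hvm hκm hκ0 hκM] at hlim'
    simp only [hκe] at hlim'
    refine (le_of_tendsto_of_tendsto' (helim.comp hφ.tendsto_atTop) hlim' fun j => ?_).trans ?_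
    · rw [Function.comp_apply, ← hGe]
      set g := G (φ j) with hg
      have hgm : Measurable g := hGm _
      have hkx (x : X) : Measurable (k x) := hk.comp measurable_prodMk_left
      have e1 : ∫⁻ x, ∫⁻ y, ENNReal.ofReal (u (φ j) x) * ENNReal.ofReal (u (φ j) y) *
          min (k x y) m ∂μ ∂μ = ∫⁻ x, ∫⁻ y, g x * g y * min (k x y) m ∂μ ∂μ := by
        refine lintegral_congr_ae ((huG (φ j)).mono fun x hx => ?_)
        refine lintegral_congr_ae ((huG (φ j)).mono fun y hy => ?_)
        simp only at hx hy ⊢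
        rw [hx, hy]
      have e2 : ∫⁻ x, ∫⁻ y, g x * g y * k x y ^ (1 + δ) ∂μ ∂μ ≤ 2 * C * R :=
        (lintegral_kernel_le (hk.pow_const (1 + δ)) (fun x y => by rw [hsymm]) hkC hgm).trans
          (by gcongr; exact hsq (hGA _))
      rw [e1]
      refine le_trans ?_ (add_le_add le_rfl (mul_le_mul_right e2 (m ^ (-δ))))
      have hm1 : Measurable fun z : X × X => g z.1 * g z.2 * min (k z.1 z.2) m :=
        ((hgm.comp measurable_fst).mul (hgm.comp measurable_snd)).mul (hk.min measurable_const)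
      have hm2 : Measurable fun z : X × X => g z.1 * g z.2 * k z.1 z.2 ^ (1 + δ) :=
        ((hgm.comp measurable_fst).mul (hgm.comp measurable_snd)).mul (hk.pow_const _)
      rw [← lintegral_const_mul _ hm2.lintegral_prod_right',
        ← lintegral_add_left hm1.lintegral_prod_right']
      refine lintegral_mono fun x => ?_
      have hm1x : Measurable fun y => g x * g y * min (k x y) m :=
        hm1.comp measurable_prodMk_left
      have hm2x : Measurable fun y => g x * g y * k x y ^ (1 + δ) :=
        hm2.comp measurable_prodMk_left
      simp only
      rw [← lintegral_const_mul _ hm2x, ← lintegral_add_left hm1x]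
      refine lintegral_mono fun y => ?_
      calc g x * g y * k x y
          ≤ g x * g y * (min (k x y) m + m ^ (-δ) * k x y ^ (1 + δ)) := by
            gcongr
            exact ENNReal.le_min_add_rpow hδ hm0 hmt _
        _ = _ := by ring
    · gcongr
      refine lintegral_mono fun x => lintegral_mono fun y => ?_
      gcongr
      exact min_le_left _ _
  have htail : Filter.Tendsto (fun M : ℕ => I (fun x => ENNReal.ofReal (v x)) +
      ((M + 1 : ℕ) : ℝ≥0∞) ^ (-δ) * (2 * C * R)) Filter.atTop
      (nhds (I (fun x => ENNReal.ofReal (v x)))) := by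
    have h1 : Filter.Tendsto (fun M : ℕ => ((M + 1 : ℕ) : ℝ≥0∞) ^ (-δ)) Filter.atTop (nhds 0) := by
      simp only [ENNReal.rpow_neg]
      rw [← ENNReal.inv_top]
      refine tendsto_inv_iff.2 ?_
      exact (ENNReal.tendsto_rpow_at_top hδ).comp
        (ENNReal.tendsto_nat_nhds_top.comp (Filter.tendsto_add_atTop_nat 1))
    have h2 := ENNReal.Tendsto.mul_const h1 (b := 2 * C * R)
      (Or.inr (ENNReal.mul_ne_top (ENNReal.mul_ne_top (by norm_num) hC) hRt))
    simpa using h2.const_add (I fun x => ENNReal.ofReal (v x))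
  have hsup := ge_of_tendsto' htail hbound
  refine ⟨fun x => ENNReal.ofReal (v x), hvm.ennreal_ofReal, hNv, fun G hG hGA => ?_⟩
  have hmem : I G ∈ S := ⟨G, hG, hGA, rfl⟩
  exact (le_sSup hmem).trans hsup

lemma lintegral_rieszKernel_mul {n : ℕ} (hn : 1 ≤ n) (s : ℝ) (x : Euc n) :
    ∫⁻ y : Euc n, rieszKernel s x y * ENNReal.ofReal ((1 + ‖y‖ ^ 2) ^ (-s)) =
      ENNReal.ofReal ((1 + ‖x‖ ^ 2) ^ (s - n)) *
        ∫⁻ z : Euc n, ENNReal.ofReal ((1 + ‖z‖ ^ 2) ^ (-s)) := by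
  set r : ℝ := √(1 + ‖x‖ ^ 2) with hrdef
  have hr : 0 < r := Real.sqrt_pos.2 (by positivity)
  have hr2 : r ^ 2 = 1 + 0 + ‖x‖ ^ 2 := by
    rw [hrdef, Real.sq_sqrt (by positivity)]; ring
  rw [← lintegral_kelvin hn x hr, ← lintegral_const_mul' _ _ ENNReal.ofReal_ne_top]
  refine lintegral_congr_ae ?_
  filter_upwards [ae_ne_point hn x] with z hz
  have hd : 0 < dist z x := dist_pos.2 hz
  have h1 := one_add_sq_norm_inversion hr hr2 hz
  have hz0 : 0 < 1 + ‖z‖ ^ 2 := by positivity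
  have h2 : 1 + ‖inversion x r z‖ ^ 2 = (1 + ‖z‖ ^ 2) * (r / dist z x) ^ (2 : ℝ) := by
    have : (r / dist z x) ^ (2 : ℝ) = (r / dist z x) ^ 2 := by norm_cast
    rw [this]
    simp only [zero_mul, zero_div, add_zero] at h1
    rw [← h1]
    field_simp
  have h3 : dist x (inversion x r z) = r * (r / dist z x) := by
    rw [dist_comm, EuclideanGeometry.dist_inversion_center]
    ring
  simp only [kelvin, rieszKernel]
  rw [h2, h3, ← ENNReal.ofReal_mul (by positivity), ← ENNReal.ofReal_mul (by positivity),
    ← ENNReal.ofReal_mul (by positivity)]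
  congr 1
  have hρ : 0 < r / dist z x := by positivity
  have hx2 : 1 + ‖x‖ ^ 2 = r ^ (2 : ℝ) := by
    have : r ^ (2 : ℝ) = r ^ 2 := by norm_cast
    rw [this, hr2]; ring
  rw [hx2, Real.mul_rpow hr.le hρ.le, Real.mul_rpow hz0.le (by positivity), ← Real.rpow_mul hρ.le,
    ← Real.rpow_mul hr.le]
  have e1 : (r / dist z x) ^ (2 * (n : ℝ)) * (r / dist z x) ^ (2 * s - 2 * (n : ℝ)) *
      (r / dist z x) ^ (2 * -s) = 1 := by
    rw [← Real.rpow_add hρ, ← Real.rpow_add hρ, ← Real.rpow_zero (r / dist z x)]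
    congr 1
    ring
  have e2 : 2 * (s - (n : ℝ)) = 2 * s - 2 * n := by ring
  rw [e2]
  linear_combination r ^ (2 * s - 2 * (n : ℝ)) * (1 + ‖z‖ ^ 2) ^ (-s) * e1

lemma rieszEnergy_extremal {n : ℕ} (hn : 1 ≤ n) (s : ℝ) :
    rieszEnergy s (fun x : Euc n => ENNReal.ofReal ((1 + ‖x‖ ^ 2) ^ (-s))) =
      (∫⁻ z : Euc n, ENNReal.ofReal ((1 + ‖z‖ ^ 2) ^ (-s))) *
        ∫⁻ z : Euc n, ENNReal.ofReal ((1 + ‖z‖ ^ 2) ^ (-(n : ℝ))) := by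
  unfold rieszEnergy
  have hm : Measurable fun z : Euc n => ENNReal.ofReal ((1 + ‖z‖ ^ 2) ^ (-(n : ℝ))) := by fun_prop
  rw [← lintegral_const_mul _ hm]
  refine lintegral_congr fun x => ?_
  have h0 : 0 < 1 + ‖x‖ ^ 2 := by positivity
  simp only [mul_assoc, mul_comm (ENNReal.ofReal ((1 + ‖_‖ ^ 2) ^ (-s))) (rieszKernel s x _)]
  rw [lintegral_const_mul' _ _ ENNReal.ofReal_ne_top, lintegral_rieszKernel_mul hn, ← mul_assoc,
    mul_comm, ← ENNReal.ofReal_mul (by positivity), ← Real.rpow_add h0]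
  congr 4
  ring

/-- Powers of the conformal factor of stereographic projection. -/
def bubble {n : ℕ} (s : ℝ) (x : Euc n) : ℝ≥0∞ := ENNReal.ofReal ((1 + ‖x‖ ^ 2) ^ (-s))

lemma measurable_bubble {n : ℕ} (s : ℝ) : Measurable (bubble (n := n) s) := by
  unfold bubble
  fun_prop

lemma bubble_ne_top {n : ℕ} (s : ℝ) (x : Euc n) : bubble s x ≠ ∞ := ENNReal.ofReal_ne_top

lemma bubble_mul {n : ℕ} (a b : ℝ) (x : Euc n) : bubble a x * bubble b x = bubble (a + b) x := by
  have h0 : 0 < 1 + ‖x‖ ^ 2 := by positivity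
  unfold bubble
  rw [← ENNReal.ofReal_mul (by positivity), ← Real.rpow_add h0, neg_add]

lemma bubble_zero {n : ℕ} (x : Euc n) : bubble 0 x = 1 := by simp [bubble]

lemma bubble_rpow {n : ℕ} (a : ℝ) {t : ℝ} (ht : 0 ≤ t) (x : Euc n) :
    bubble a x ^ t = bubble (a * t) x := by
  unfold bubble
  rw [ENNReal.ofReal_rpow_of_nonneg (by positivity) ht, ← Real.rpow_mul (by positivity), neg_mul]

lemma rieszKernel_comm {n : ℕ} (s : ℝ) (x y : Euc n) : rieszKernel s x y = rieszKernel s y x := by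
  simp only [rieszKernel, dist_comm]

/-- The image of the surface measure of the sphere under stereographic projection. -/
def sphereMeasure (n : ℕ) : Measure (Euc n) := volume.withDensity (bubble n)

lemma lintegral_sphereMeasure {n : ℕ} (F : Euc n → ℝ≥0∞) :
    ∫⁻ x, F x ∂sphereMeasure n = ∫⁻ x, bubble n x * F x :=
  lintegral_withDensity_eq_lintegral_mul_non_measurable _ (measurable_bubble _)
    (Filter.Eventually.of_forall fun x => (bubble_ne_top _ x).lt_top) F

lemma lintegral_bubble_ne_top {n : ℕ} {s : ℝ} (hs0 : 0 < s) (hs : (n : ℝ) / 2 < s) :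
    ∫⁻ x : Euc n, bubble s x ≠ ∞ := by
  unfold bubble
  rw [lintegral_one_add_sq_norm_rpow hs0 hs]
  exact ENNReal.ofReal_ne_top

lemma lintegral_bubble_ne_zero {n : ℕ} (s : ℝ) : ∫⁻ x : Euc n, bubble s x ≠ 0 := by
  intro h
  rw [lintegral_eq_zero_iff (measurable_bubble _)] at h
  obtain ⟨x, hx⟩ := h.exists
  have : 0 < bubble s x := ENNReal.ofReal_pos.2 (by positivity)
  exact this.ne' hx

lemma isFiniteMeasure_sphereMeasure {n : ℕ} (hn : 1 ≤ n) : IsFiniteMeasure (sphereMeasure n) := by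
  have hn' : (0 : ℝ) < n := by exact_mod_cast hn
  exact isFiniteMeasure_withDensity (lintegral_bubble_ne_top hn' (half_lt_self hn'))

/-- The Riesz kernel transplanted to the sphere. -/
def sphereKernel {n : ℕ} (s : ℝ) (x y : Euc n) : ℝ≥0∞ :=
  rieszKernel s x y * (bubble (s - n) x * bubble (s - n) y)

lemma measurable_sphereKernel {n : ℕ} (s : ℝ) :
    Measurable fun z : Euc n × Euc n => sphereKernel s z.1 z.2 :=
  (measurable_rieszKernel s).mul (((measurable_bubble _).comp measurable_fst).mul
    ((measurable_bubble _).comp measurable_snd))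

lemma sphereKernel_comm {n : ℕ} (s : ℝ) (x y : Euc n) :
    sphereKernel s x y = sphereKernel s y x := by
  unfold sphereKernel
  rw [rieszKernel_comm, mul_comm (bubble _ x)]

lemma sphereKernel_rpow {n : ℕ} (s : ℝ) {t : ℝ} (ht : 0 ≤ t) (x y : Euc n) :
    sphereKernel s x y ^ t = sphereKernel (n - (n - s) * t) x y := by
  unfold sphereKernel
  rw [ENNReal.mul_rpow_of_nonneg _ _ ht, ENNReal.mul_rpow_of_nonneg _ _ ht, bubble_rpow _ ht,
    bubble_rpow _ ht]
  unfold rieszKernel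
  rw [ENNReal.ofReal_rpow_of_nonneg (by positivity) ht, ← Real.rpow_mul dist_nonneg]
  ring_nf

lemma lintegral_sphereKernel {n : ℕ} (hn : 1 ≤ n) (s : ℝ) (x : Euc n) :
    ∫⁻ y, sphereKernel s x y ∂sphereMeasure n = ∫⁻ z : Euc n, bubble s z := by
  rw [lintegral_sphereMeasure]
  have h (y : Euc n) : bubble n y * sphereKernel s x y =
      bubble (s - n) x * (rieszKernel s x y * bubble s y) := by
    have : bubble s y = bubble n y * bubble (s - n) y := by rw [bubble_mul]; congr 1; ring
    rw [this]
    unfold sphereKernel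
    ring
  simp only [h]
  rw [lintegral_const_mul' _ _ (bubble_ne_top _ _)]
  unfold bubble
  rw [lintegral_rieszKernel_mul hn, ← mul_assoc]
  change bubble (s - n) x * ENNReal.ofReal ((1 + ‖x‖ ^ 2) ^ (s - n)) * _ = _
  rw [← neg_sub (n : ℝ) s]
  change bubble _ x * bubble _ x * _ = _
  rw [bubble_mul, neg_add_cancel, bubble_zero, one_mul]

lemma rieszEnergy_mul_bubble {n : ℕ} (s : ℝ) (F : Euc n → ℝ≥0∞) :
    ∫⁻ x, ∫⁻ y, F x * F y * sphereKernel s x y ∂sphereMeasure n ∂sphereMeasure n =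
      rieszEnergy s fun x => F x * bubble s x := by
  rw [lintegral_sphereMeasure]
  unfold rieszEnergy
  refine lintegral_congr fun x => ?_
  rw [lintegral_sphereMeasure, ← lintegral_const_mul' _ _ (bubble_ne_top _ _)]
  refine lintegral_congr fun y => ?_
  have h (z : Euc n) : bubble s z = bubble n z * bubble (s - n) z := by
    rw [bubble_mul]; congr 1; ring
  simp only [h x, h y]
  unfold sphereKernel
  ring

lemma penalty_mul_bubble {n : ℕ} {s : ℝ} (hs : 0 < s) (ε : ℝ≥0∞) (F : Euc n → ℝ≥0∞) :
    ∫⁻ x, F x ^ (n / s) ∂sphereMeasure n + ε * ∫⁻ x, F x ^ 2 ∂sphereMeasure n =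
      penalty s ε fun x => F x * bubble s x := by
  rw [lintegral_sphereMeasure, lintegral_sphereMeasure]
  unfold penalty
  have h0 : 0 ≤ (n : ℝ) / s := by positivity
  congr 1
  · refine lintegral_congr fun x => ?_
    rw [ENNReal.mul_rpow_of_nonneg _ _ h0, bubble_rpow _ h0, mul_div_cancel₀ _ hs.ne', mul_comm]
  · congr 1
    refine lintegral_congr fun x => ?_
    have hW : sphereWeight s x = bubble (n - 2 * s) x := by
      unfold sphereWeight bubble; rw [neg_sub]
    have h2 : bubble s x ^ 2 = bubble (2 * s) x := by rw [sq, bubble_mul, two_mul]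
    rw [hW, mul_pow, h2, mul_assoc, bubble_mul, mul_comm]
    congr 2
    ring

lemma exists_riesz_maximizer {n : ℕ} (hn : 1 ≤ n) {s : ℝ} (hs : (n : ℝ) / 2 < s) (hsn : s < n)
    {ε : ℝ} (hε : 0 < ε) {A : ℝ≥0∞} (hA : A ≠ ∞) :
    ∃ f : Euc n → ℝ≥0∞, Measurable f ∧ penalty s (ENNReal.ofReal ε) f ≤ A ∧
      rieszEnergy s f ≠ ∞ ∧ ∀ g : Euc n → ℝ≥0∞, Measurable g →
        penalty s (ENNReal.ofReal ε) g ≤ A → rieszEnergy s g ≤ rieszEnergy s f := by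
  have hn' : (0 : ℝ) < n := by exact_mod_cast hn
  have hs0 : 0 < s := by linarith
  have := isFiniteMeasure_sphereMeasure hn
  set δ : ℝ := (s - n / 2) / (2 * (n - s)) with hδdef
  have hδ : 0 < δ := div_pos (by linarith) (by linarith)
  have hδs : (n : ℝ) - (n - s) * (1 + δ) = s - (s - n / 2) / 2 := by
    have : (n : ℝ) - s ≠ 0 := by linarith
    rw [hδdef]
    field_simp
    ring
  have hC : ∫⁻ z : Euc n, bubble (n - (n - s) * (1 + δ)) z ≠ ∞ := by
    rw [hδs]
    exact lintegral_bubble_ne_top (by linarith) (by linarith)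
  obtain ⟨F, hF, hFA, hmax⟩ := exists_maximizer (μ := sphereMeasure n)
    (measurable_sphereKernel s) (sphereKernel_comm s) hδ hC
    (fun x => by
      simp only [sphereKernel_rpow s (by linarith : (0 : ℝ) ≤ 1 + δ)]
      rw [lintegral_sphereKernel hn]) (p := n / s)
    ((one_lt_div hs0).2 hsn) ((div_le_iff₀ hs0).2 (by linarith)) hε hA
  refine ⟨fun x => F x * bubble s x, hF.mul (measurable_bubble s), ?_, ?_, fun g hg hgA => ?_⟩
  · rwa [← penalty_mul_bubble hs0]
  · rw [← rieszEnergy_mul_bubble]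
    refine ne_top_of_le_ne_top ?_ (lintegral_kernel_le (measurable_sphereKernel s)
      (sphereKernel_comm s) (fun x => (lintegral_sphereKernel hn s x).le) hF)
    refine ENNReal.mul_ne_top (ENNReal.mul_ne_top (by norm_num) (lintegral_bubble_ne_top hs0 hs)) ?_
    intro h
    rw [h, ENNReal.mul_top (ENNReal.ofReal_pos.2 hε).ne', add_top] at hFA
    exact hA (top_le_iff.1 hFA)
  · have hgF : (fun x => g x * bubble (-s) x * bubble s x) = g := by
      ext x
      rw [mul_assoc, bubble_mul, neg_add_cancel, bubble_zero, mul_one]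
    have h := hmax (fun x => g x * bubble (-s) x) (hg.mul (measurable_bubble _)) (by
      rwa [penalty_mul_bubble hs0, hgF])
    rwa [rieszEnergy_mul_bubble, rieszEnergy_mul_bubble, hgF] at h

lemma rieszEnergy_congr_ae {n : ℕ} (s : ℝ) {f g : Euc n → ℝ≥0∞} (h : f =ᵐ[volume] g) :
    rieszEnergy s f = rieszEnergy s g := by
  unfold rieszEnergy
  refine lintegral_congr_ae (h.mono fun x hx => lintegral_congr_ae (h.mono fun y hy => ?_))
  simp only [hx, hy]

lemma rieszEnergy_le_of_penalty_le {n : ℕ} (hn : 1 ≤ n) {s : ℝ} (hs : (n : ℝ) / 2 < s)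
    (hsn : s < n) {ε : ℝ} (hε : 0 < ε) {A : ℝ≥0∞} (hA : A ≠ ∞) {g : Euc n → ℝ≥0∞}
    (hg : Measurable g) (hgA : penalty s (ENNReal.ofReal ε) g ≤ A) :
    rieszEnergy s g ≤
      (A / ∫⁻ x : Euc n, bubble n x) ^ (2 * s / n) * rieszEnergy s (bubble (n := n) s) := by
  have hn' : (0 : ℝ) < n := by exact_mod_cast hn
  have hs0 : 0 < s := by linarith
  rcases eq_or_ne (rieszEnergy s g) 0 with h0 | h0
  · rw [h0]; exact zero_le
  obtain ⟨f, hf, hfA, hft, hmax⟩ := exists_riesz_maximizer hn hs hsn hε hA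
  have hf0 : rieszEnergy s f ≠ 0 :=
    (lt_of_lt_of_le (pos_iff_ne_zero.2 h0) (hmax g hg hgA)).ne'
  obtain ⟨a, ha⟩ := exists_ae_eq_of_kelvin_le (s := s) hn hf fun τ hτ hτ1 c => by
    have h1 : 0 < 1 + τ + ‖c‖ ^ 2 := by nlinarith [sq_nonneg ‖c‖]
    exact kelvin_le_of_maximizer hn hs hsn (ENNReal.ofReal_pos.2 hε).ne' hA hf hfA hf0 hft hmax hτ
      (Real.sqrt_pos.2 h1) (Real.sq_sqrt h1.le)
  change f =ᵐ[volume] fun x => a * bubble s x at ha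
  refine (hmax g hg hgA).trans ?_
  rw [rieszEnergy_congr_ae s ha, rieszEnergy_const_mul s (measurable_bubble s)]
  gcongr
  have hp0 : 0 < (n : ℝ) / s := by positivity
  have hle : a ^ ((n : ℝ) / s) ≤ A / ∫⁻ x : Euc n, bubble n x := by
    rw [ENNReal.le_div_iff_mul_le (Or.inl (lintegral_bubble_ne_zero _))
      (Or.inl (lintegral_bubble_ne_top hn' (half_lt_self hn'))),
      ← lintegral_const_mul _ (measurable_bubble _)]
    refine le_trans (le_of_eq ?_) (le_self_add.trans hfA)
    refine lintegral_congr_ae (ha.mono fun x hx => ?_)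
    simp only
    rw [hx, ENNReal.mul_rpow_of_nonneg _ _ hp0.le, bubble_rpow _ hp0.le, mul_div_cancel₀ _ hs0.ne']
  calc a ^ 2 = (a ^ ((n : ℝ) / s)) ^ (2 * s / n) := by
        rw [← ENNReal.rpow_mul]
        have : (n : ℝ) / s * (2 * s / n) = (2 : ℕ) := by push_cast; field_simp
        rw [this, ENNReal.rpow_natCast]
    _ ≤ _ := ENNReal.rpow_le_rpow hle (by positivity)

lemma rieszEnergy_bubble {n : ℕ} (hn : 1 ≤ n) (s : ℝ) :
    rieszEnergy s (bubble (n := n) s) =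
      (∫⁻ z : Euc n, bubble s z) * ∫⁻ z : Euc n, bubble n z :=
  rieszEnergy_extremal hn s

lemma rieszEnergy_le_of_weighted_ne_top {n : ℕ} (hn : 1 ≤ n) {s : ℝ} (hs : (n : ℝ) / 2 < s)
    (hsn : s < n) {g : Euc n → ℝ≥0∞} (hg : Measurable g) (hP : ∫⁻ x, g x ^ (n / s) ≠ ∞)
    (hW : ∫⁻ x, g x ^ 2 * sphereWeight s x ≠ ∞) :
    rieszEnergy s g ≤ ((∫⁻ x, g x ^ (n / s)) / ∫⁻ x : Euc n, bubble n x) ^ (2 * s / n) *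
      rieszEnergy s (bubble (n := n) s) := by
  have hn' : (0 : ℝ) < n := by exact_mod_cast hn
  have hs0 : 0 < s := by linarith
  have hE : rieszEnergy s (bubble (n := n) s) ≠ ∞ := by
    rw [rieszEnergy_bubble hn]
    exact ENNReal.mul_ne_top (lintegral_bubble_ne_top hs0 hs)
      (lintegral_bubble_ne_top hn' (half_lt_self hn'))
  set P := ∫⁻ x, g x ^ (n / s) with hPdef
  set Q := ∫⁻ x, g x ^ 2 * sphereWeight s x with hQdef
  have hle (k : ℕ) : rieszEnergy s g ≤
      ((P + ENNReal.ofReal (1 / ((k : ℝ) + 1)) * Q) / ∫⁻ x : Euc n, bubble n x) ^ (2 * s / n) *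
        rieszEnergy s (bubble (n := n) s) :=
    rieszEnergy_le_of_penalty_le hn hs hsn Nat.one_div_pos_of_nat
      (ENNReal.add_ne_top.2 ⟨hP, ENNReal.mul_ne_top ENNReal.ofReal_ne_top hW⟩) hg le_rfl
  refine ge_of_tendsto' (x := Filter.atTop) ?_ hle
  refine ENNReal.Tendsto.mul_const ?_ (Or.inr hE)
  refine (ENNReal.continuous_rpow_const.tendsto _).comp ?_
  refine ENNReal.Tendsto.div_const ?_ (Or.inr (lintegral_bubble_ne_zero _))
  have h1 := ENNReal.tendsto_ofReal (tendsto_one_div_add_atTop_nhds_zero_nat (𝕜 := ℝ))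
  simpa using (ENNReal.Tendsto.mul_const h1 (Or.inr hW)).const_add P

/-- Truncation of a function in height and in space. -/
def truncate {n : ℕ} (g : Euc n → ℝ≥0∞) (k : ℕ) : Euc n → ℝ≥0∞ :=
  (Metric.closedBall 0 k).indicator fun x => min (g x) k

lemma measurable_truncate {n : ℕ} {g : Euc n → ℝ≥0∞} (hg : Measurable g) (k : ℕ) :
    Measurable (truncate g k) :=
  (hg.min measurable_const).indicator measurableSet_closedBall

lemma truncate_le {n : ℕ} (g : Euc n → ℝ≥0∞) (k : ℕ) (x : Euc n) : truncate g k x ≤ g x :=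
  (Set.indicator_le_self' (fun _ _ => zero_le) x).trans (min_le_left _ _)

lemma monotone_truncate {n : ℕ} (g : Euc n → ℝ≥0∞) (x : Euc n) :
    Monotone fun k => truncate g k x := by
  intro j k hjk
  have hjk' : (j : ℝ) ≤ k := by exact_mod_cast hjk
  classical
  simp only [truncate, Set.indicator_apply]
  split_ifs with h1 h2
  · exact min_le_min le_rfl (by exact_mod_cast hjk)
  · exact absurd (Metric.closedBall_subset_closedBall hjk' h1) h2
  · exact zero_le
  · exact le_rfl

lemma eventually_truncate_eq {n : ℕ} {g : Euc n → ℝ≥0∞} {x : Euc n} (hx : g x ≠ ∞) :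
    ∀ᶠ k in Filter.atTop, truncate g k x = g x := by
  obtain ⟨j, hj⟩ := exists_nat_ge (max ‖x‖ (g x).toReal)
  filter_upwards [Filter.eventually_ge_atTop j] with k hk
  have hk' : (j : ℝ) ≤ k := by exact_mod_cast hk
  rw [truncate, Set.indicator_of_mem, min_eq_left]
  · rw [← ENNReal.ofReal_toReal hx, ← ENNReal.ofReal_natCast]
    exact ENNReal.ofReal_le_ofReal ((le_max_right _ _).trans (hj.trans hk'))
  · rw [mem_closedBall_zero_iff]
    exact (le_max_left _ _).trans (hj.trans hk')

lemma lintegral_truncate_weighted_ne_top {n : ℕ} {s : ℝ} (hs : (n : ℝ) / 2 < s)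
    (g : Euc n → ℝ≥0∞) (k : ℕ) : ∫⁻ x, truncate g k x ^ 2 * sphereWeight s x ≠ ∞ := by
  set c : ℝ≥0∞ := (k : ℝ≥0∞) ^ 2 * ENNReal.ofReal ((1 + (k : ℝ) ^ 2) ^ (2 * s - n)) with hc
  have hct : c ≠ ∞ :=
    ENNReal.mul_ne_top (ENNReal.pow_ne_top (ENNReal.natCast_ne_top _)) ENNReal.ofReal_ne_top
  refine ne_top_of_le_ne_top (b := ∫⁻ x : Euc n, (Metric.closedBall 0 k).indicator (fun _ => c) x)
    ?_ (lintegral_mono fun x => ?_)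
  · rw [lintegral_indicator_const measurableSet_closedBall]
    exact ENNReal.mul_ne_top hct measure_closedBall_lt_top.ne
  · by_cases hx : x ∈ Metric.closedBall (0 : Euc n) k
    · rw [truncate, Set.indicator_of_mem hx, Set.indicator_of_mem hx, hc]
      have hx' : ‖x‖ ≤ k := mem_closedBall_zero_iff.1 hx
      have h0 : 0 ≤ 2 * s - n := by linarith
      unfold sphereWeight
      gcongr
      exact min_le_right _ _
    · rw [truncate, Set.indicator_of_notMem hx]
      simp

lemma tendsto_rieszEnergy_truncate {n : ℕ} (s : ℝ) {g : Euc n → ℝ≥0∞} (hg : Measurable g)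
    (hgt : ∀ x, g x ≠ ∞) :
    Filter.Tendsto (fun k => rieszEnergy s (truncate g k)) Filter.atTop
      (nhds (rieszEnergy s g)) := by
  have hm {f : Euc n → ℝ≥0∞} (hf : Measurable f) :
      Measurable fun z : Euc n × Euc n => f z.1 * f z.2 * rieszKernel s z.1 z.2 :=
    ((hf.comp measurable_fst).mul (hf.comp measurable_snd)).mul (measurable_rieszKernel s)
  have hE {f : Euc n → ℝ≥0∞} (hf : Measurable f) : rieszEnergy s f =
      ∫⁻ z : Euc n × Euc n, f z.1 * f z.2 * rieszKernel s z.1 z.2 := by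
    rw [Measure.volume_eq_prod, lintegral_prod _ (hm hf).aemeasurable]
    rfl
  simp only [hE hg, hE (measurable_truncate hg _)]
  refine lintegral_tendsto_of_tendsto_of_monotone
    (fun k => (hm (measurable_truncate hg k)).aemeasurable)
    (Filter.Eventually.of_forall fun z j k hjk => ?_)
    (Filter.Eventually.of_forall fun z => ?_)
  · simp only
    gcongr
    · exact monotone_truncate g _ hjk
    · exact monotone_truncate g _ hjk
  · refine tendsto_const_nhds.congr' ?_
    filter_upwards [eventually_truncate_eq (hgt z.1), eventually_truncate_eq (hgt z.2)] with k h1 h2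
    rw [h1, h2]

/-- The sharp Hardy–Littlewood–Sobolev inequality in the diagonal case. -/
lemma rieszEnergy_le {n : ℕ} (hn : 1 ≤ n) {s : ℝ} (hs : (n : ℝ) / 2 < s) (hsn : s < n)
    {g : Euc n → ℝ≥0∞} (hg : Measurable g) (hgt : ∀ x, g x ≠ ∞) :
    rieszEnergy s g ≤ ((∫⁻ x, g x ^ (n / s)) / ∫⁻ x : Euc n, bubble n x) ^ (2 * s / n) *
      rieszEnergy s (bubble (n := n) s) := by
  have hn' : (0 : ℝ) < n := by exact_mod_cast hn
  have hs0 : 0 < s := by linarith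
  have hS := lintegral_bubble_ne_top hn' (half_lt_self hn')
  rcases eq_or_ne (∫⁻ x, g x ^ (n / s)) ∞ with hP | hP
  · rw [hP, ENNReal.top_div_of_ne_top hS, ENNReal.top_rpow_of_pos (by positivity),
      ENNReal.top_mul]
    · exact le_top
    · rw [rieszEnergy_bubble hn]
      exact mul_ne_zero (lintegral_bubble_ne_zero _) (lintegral_bubble_ne_zero _)
  · refine le_of_tendsto' (tendsto_rieszEnergy_truncate s hg hgt) fun k => ?_
    have hPk : ∫⁻ x, truncate g k x ^ (n / s) ≤ ∫⁻ x, g x ^ (n / s) :=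
      lintegral_mono fun x => ENNReal.rpow_le_rpow (truncate_le g k x) (by positivity)
    refine (rieszEnergy_le_of_weighted_ne_top hn hs hsn (measurable_truncate hg k)
      (ne_top_of_le_ne_top hP hPk) (lintegral_truncate_weighted_ne_top hs g k)).trans ?_
    gcongr

lemma rieszEnergy_le_gamma {n : ℕ} (hn : 1 ≤ n) {s : ℝ} (hs : (n : ℝ) / 2 < s) (hsn : s < n)
    {g : Euc n → ℝ≥0∞} (hg : Measurable g) (hgt : ∀ x, g x ≠ ∞) :
    rieszEnergy s g ≤ ENNReal.ofReal (π ^ ((n : ℝ) - s) * (Gamma (s - n / 2) / Gamma s) *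
      (Gamma n / Gamma (n / 2)) ^ (2 * s / n - 1)) * (∫⁻ x, g x ^ (n / s)) ^ (2 * s / n) := by
  have hn' : (0 : ℝ) < n := by exact_mod_cast hn
  have hs0 : 0 < s := by linarith
  have hG1 : 0 < Gamma (n : ℝ) := Gamma_pos_of_pos hn'
  have hG2 : 0 < Gamma ((n : ℝ) / 2) := Gamma_pos_of_pos (by positivity)
  have hG3 : 0 < Gamma s := Gamma_pos_of_pos hs0
  have hG4 : 0 < Gamma (s - n / 2) := Gamma_pos_of_pos (by linarith)
  have he : 0 ≤ 2 * s / n := by positivity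
  refine (rieszEnergy_le hn hs hsn hg hgt).trans (le_of_eq ?_)
  rw [rieszEnergy_bubble hn]
  have hS : ∫⁻ x : Euc n, bubble n x =
      ENNReal.ofReal (π ^ ((n : ℝ) / 2) * (Gamma n / Gamma (n / 2))⁻¹) := by
    unfold bubble
    rw [lintegral_one_add_sq_norm_rpow hn' (half_lt_self hn')]
    congr 1
    rw [inv_div, sub_half, mul_div_assoc]
  have hB : ∫⁻ x : Euc n, bubble s x =
      ENNReal.ofReal (π ^ ((n : ℝ) / 2) * (Gamma (s - n / 2) / Gamma s)) := by
    unfold bubble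
    rw [lintegral_one_add_sq_norm_rpow hs0 hs, mul_div_assoc]
  rw [hS, hB]
  set γ := Gamma (n : ℝ) / Gamma ((n : ℝ) / 2) with hγ
  have hγ0 : 0 < γ := by positivity
  have hπ := Real.pi_pos
  have hS0 : 0 < π ^ ((n : ℝ) / 2) * γ⁻¹ := by positivity
  rw [ENNReal.div_eq_inv_mul, ENNReal.mul_rpow_of_nonneg _ _ he, ← ENNReal.ofReal_inv_of_pos hS0,
    ENNReal.ofReal_rpow_of_nonneg (by positivity) he, mul_right_comm,
    ← ENNReal.ofReal_mul (by positivity), ← ENNReal.ofReal_mul (by positivity)]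
  congr 2
  rw [mul_inv, inv_inv, Real.mul_rpow (by positivity) hγ0.le, Real.rpow_sub_one hγ0.ne',
    ← Real.rpow_neg hπ.le, ← Real.rpow_mul hπ.le]
  have e1 : π ^ ((n : ℝ) - s) = π ^ (-((n : ℝ) / 2) * (2 * s / n)) * π ^ ((n : ℝ) / 2) *
      π ^ ((n : ℝ) / 2) := by
    rw [← Real.rpow_add hπ, ← Real.rpow_add hπ]
    congr 1
    field_simp
    ring
  rw [e1]
  ring

lemma lintegral_pi_prod {E : Type*} [MeasureSpace E] [SigmaFinite (volume : Measure E)] (m : ℕ)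
    {f : Fin m → E → ℝ≥0∞} (hf : ∀ k, Measurable (f k)) :
    ∫⁻ y : Fin m → E, ∏ k, f k (y k) = ∏ k, ∫⁻ x, f k x := by
  induction m with
  | zero => simp [volume_pi]
  | succ m ih =>
    have h := (volume_preserving_piFinSuccAbove (fun _ : Fin (m + 1) => E) 0).symm
    rw [← h.lintegral_comp_emb (MeasurableEquiv.measurableEmbedding _), Fin.prod_univ_succ,
      ← ih fun k => hf k.succ, Measure.volume_eq_prod]
    have hm : Measurable fun y : Fin m → E => ∏ k, f k.succ (y k) :=
      Finset.measurable_fun_prod _ fun k _ => (hf k.succ).comp (measurable_pi_apply k)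
    rw [← lintegral_prod_mul (hf 0).aemeasurable hm.aemeasurable]
    refine lintegral_congr fun z => ?_
    rw [Fin.prod_univ_succ]
    simp [MeasurableEquiv.piFinSuccAbove]

lemma lintegral_sq_prod_kernel {E : Type*} [MeasureSpace E] [SigmaFinite (volume : Measure E)]
    {m : ℕ} {K : Fin m → E → E → ℝ≥0∞} (hK : ∀ k, Measurable fun z : E × E => K k z.1 z.2)
    {g : E → ℝ≥0∞} (hg : Measurable g) :
    ∫⁻ y : Fin m → E, (∫⁻ x, (∏ k, K k (y k) x) * g x) ^ 2 =
      ∫⁻ x, ∫⁻ x', g x * g x' * ∏ k, ∫⁻ y, K k y x * K k y x' := by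
  have hP : Measurable fun z : (Fin m → E) × E => ∏ k, K k (z.1 k) z.2 :=
    Finset.measurable_fun_prod _ fun k _ => (hK k).comp
      (g := fun z : E × E => K k z.1 z.2) (f := fun z : (Fin m → E) × E => (z.1 k, z.2))
      (((measurable_pi_apply k).comp measurable_fst).prodMk measurable_snd)
  have hΦ : Measurable fun z : (Fin m → E) × E => (∏ k, K k (z.1 k) z.2) * g z.2 :=
    hP.mul (hg.comp measurable_snd)
  have hm : Measurable fun z : (Fin m → E) × E × E =>
      ((∏ k, K k (z.1 k) z.2.1) * g z.2.1) * ((∏ k, K k (z.1 k) z.2.2) * g z.2.2) :=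
    (hΦ.comp (measurable_fst.prodMk measurable_snd.fst)).mul
      (hΦ.comp (measurable_fst.prodMk measurable_snd.snd))
  have hm' : Measurable fun z : (Fin m → E) × E => ∫⁻ x',
      ((∏ k, K k (z.1 k) z.2) * g z.2) * ((∏ k, K k (z.1 k) x') * g x') :=
    Measurable.lintegral_prod_right' (f := fun w : ((Fin m → E) × E) × E =>
      ((∏ k, K k (w.1.1 k) w.1.2) * g w.1.2) * ((∏ k, K k (w.1.1 k) w.2) * g w.2))
      (hm.comp (measurable_fst.fst.prodMk (measurable_fst.snd.prodMk measurable_snd)))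
  have hsq (y : Fin m → E) : (∫⁻ x, (∏ k, K k (y k) x) * g x) ^ 2 =
      ∫⁻ x, ∫⁻ x', ((∏ k, K k (y k) x) * g x) * ((∏ k, K k (y k) x') * g x') := by
    have hy : Measurable fun x => (∏ k, K k (y k) x) * g x := hΦ.comp measurable_prodMk_left
    rw [sq, ← lintegral_mul_const _ hy]
    refine lintegral_congr fun x => ?_
    rw [lintegral_const_mul _ hy]
  simp only [hsq]
  rw [lintegral_lintegral_swap hm'.aemeasurable]
  refine lintegral_congr fun x => ?_
  have hmx : Measurable fun z : (Fin m → E) × E =>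
      ((∏ k, K k (z.1 k) x) * g x) * ((∏ k, K k (z.1 k) z.2) * g z.2) :=
    hm.comp (measurable_fst.prodMk (measurable_const.prodMk measurable_snd))
  rw [lintegral_lintegral_swap hmx.aemeasurable]
  refine lintegral_congr fun x' => ?_
  have hKk (k : Fin m) : Measurable fun y => K k y x * K k y x' :=
    ((hK k).comp measurable_prodMk_right).mul ((hK k).comp measurable_prodMk_right)
  have hKp : Measurable fun y : Fin m → E => ∏ k, K k (y k) x * K k (y k) x' :=
    Finset.measurable_fun_prod _ fun k _ => (hKk k).comp (measurable_pi_apply k)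
  rw [← lintegral_pi_prod m (f := fun k y => K k y x * K k y x') hKk, ← lintegral_const_mul _ hKp]
  refine lintegral_congr fun y => ?_
  rw [Finset.prod_mul_distrib]
  ring

/-- The constant produced by composing the Riesz potentials of order `a / 2` twice. -/
def rieszConst (n : ℕ) (a : ℝ) : ℝ :=
  Gamma (a / 4) ^ 2 * Gamma ((n - a) / 2) / (Gamma ((2 * n - a) / 4) ^ 2 * Gamma (a / 2))

lemma rieszConst_nonneg {n : ℕ} {a : ℝ} (ha : 0 < a) (han : a < n) : 0 ≤ rieszConst n a := by
  have h1 : 0 ≤ Gamma ((n - a) / 2) := (Gamma_pos_of_pos (by linarith)).le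
  have h2 : 0 ≤ Gamma (a / 2) := (Gamma_pos_of_pos (by linarith)).le
  unfold rieszConst
  positivity

lemma lintegral_riesz_sq {n : ℕ} (hn : 1 ≤ n) {a : ℝ} (ha : 0 < a) (han : a < n) {x x' : Euc n}
    (hx : x ≠ x') :
    ∫⁻ y : Euc n, ENNReal.ofReal (‖y - x‖ ^ (a / 2 - n)) * ENNReal.ofReal (‖y - x'‖ ^ (a / 2 - n)) =
      ENNReal.ofReal (π ^ ((n : ℝ) / 2) * rieszConst n a) *
        ENNReal.ofReal (‖x - x'‖ ^ (a - n)) := by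
  have h := lintegral_riesz_mul_riesz hn (a := n - a / 2) (b := n - a / 2)
    (by linarith) (by linarith) (by linarith) (by linarith) (by linarith) hx
  rw [neg_sub] at h
  rw [h, rieszConst, sq, sq]
  ring_nf

/-- Squaring the multilinear potential and integrating out the outer variables leaves a Riesz
energy. -/
lemma lintegral_sq_multilinear_riesz {m n : ℕ} (hn : 1 ≤ n) {α : Fin m → ℝ}
    (hα : ∀ k, 0 < α k ∧ α k < n) {g : Euc n → ℝ≥0∞} (hg : Measurable g) :
    ∫⁻ y : Fin m → Euc n,
        (∫⁻ x : Euc n, (∏ k, ENNReal.ofReal (‖y k - x‖ ^ (α k / 2 - n))) * g x) ^ 2 =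
      ENNReal.ofReal (∏ k, π ^ ((n : ℝ) / 2) * rieszConst n (α k)) *
        rieszEnergy (n - (m * n - ∑ k, α k) / 2) g := by
  rw [lintegral_sq_prod_kernel
    (K := fun k (y x : Euc n) => ENNReal.ofReal (‖y - x‖ ^ (α k / 2 - n)))
    (fun k => by fun_prop) hg]
  unfold rieszEnergy
  rw [← lintegral_const_mul' _ _ ENNReal.ofReal_ne_top]
  refine lintegral_congr fun x => ?_
  rw [← lintegral_const_mul' _ _ ENNReal.ofReal_ne_top]
  refine lintegral_congr_ae ?_
  filter_upwards [ae_ne_point hn x] with x' hx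
  have hx0 : 0 < ‖x - x'‖ := norm_pos_iff.2 (sub_ne_zero.2 hx.symm)
  have hker : rieszKernel (n - (m * n - ∑ k, α k) / 2) x x' =
      ENNReal.ofReal (‖x - x'‖ ^ ∑ k, (α k - n)) := by
    unfold rieszKernel
    rw [dist_eq_norm]
    congr 2
    simp only [Finset.sum_sub_distrib, Finset.sum_const, Finset.card_univ, Fintype.card_fin,
      nsmul_eq_mul]
    ring
  rw [Finset.prod_congr rfl fun k _ => lintegral_riesz_sq hn (hα k).1 (hα k).2 hx.symm,
    Finset.prod_mul_distrib,
    ← ENNReal.ofReal_prod_of_nonneg fun k _ =>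
      mul_nonneg (by positivity) (rieszConst_nonneg (hα k).1 (hα k).2),
    ← ENNReal.ofReal_prod_of_nonneg fun k _ => by positivity, ← Real.rpow_sum_of_pos hx0, hker]
  ring

/-- **Dual form of the multilinear Hardy–Littlewood–Sobolev inequality.**
For `0 < α_k < n`, `(m−1)n < α = Σ α_k < mn`, `q = 2n/(mn−α)`, `p = q/(q−1)`,
and nonnegative measurable `g`,
`∫ (∫ Π_k |y_k−x|^{−(n−α_k/2)} g(x) dx)² dy ≤ G_α (∫ g^p)^{2/p}`. -/
theorem stmt9 (m n : ℕ) (hm : 1 ≤ m) (hn : 1 ≤ n)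
    (α : Fin m → ℝ) (hα : ∀ k, 0 < α k ∧ α k < n)
    (hlow : ((m : ℝ) - 1) * n < ∑ k, α k) (hhigh : (∑ k, α k) < m * n)
    (q p : ℝ) (hq : q = 2 * n / ((m : ℝ) * n - ∑ k, α k)) (hp : p = q / (q - 1))
    (g : EuclideanSpace ℝ (Fin n) → ℝ)
    (hg : Measurable g) (hg0 : ∀ x, 0 ≤ g x) :
    (∫⁻ y : Fin m → EuclideanSpace ℝ (Fin n),
        (∫⁻ x : EuclideanSpace ℝ (Fin n),
          (∏ k, ENNReal.ofReal (‖y k - x‖ ^ (α k / 2 - n))) * ENNReal.ofReal (g x)) ^ (2 : ℕ)) ≤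
      ENNReal.ofReal
        (Real.pi ^ ((m : ℝ) * n / 2 + (n : ℝ) / q) *
          (∏ k, Real.Gamma (α k / 4) ^ 2 * Real.Gamma (((n : ℝ) - α k) / 2) /
            (Real.Gamma ((2 * (n : ℝ) - α k) / 4) ^ 2 * Real.Gamma (α k / 2))) *
          (Real.Gamma ((n : ℝ) / p - (n : ℝ) / 2) / Real.Gamma ((n : ℝ) / p)) *
          (Real.Gamma (n : ℝ) / Real.Gamma ((n : ℝ) / 2)) ^ (2 / p - 1)) *
        (∫⁻ x, ENNReal.ofReal (g x) ^ p) ^ (2 / p) := by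
  have hn' : (0 : ℝ) < n := by exact_mod_cast hn
  set lam : ℝ := m * n - ∑ k, α k with hlam
  have hlam0 : 0 < lam := by linarith
  have hlamn : lam < n := by linarith
  set s : ℝ := n - lam / 2 with hs
  have hs0 : 0 < s := by linarith
  have hps : p = n / s := by
    have h1 : 2 * (n : ℝ) - lam ≠ 0 := by linarith
    rw [hp, hq, hs]
    field_simp
  have hnp : (n : ℝ) / p = s := by rw [hps]; field_simp
  have h2p : 2 / p = 2 * s / n := by rw [hps]; field_simp
  have hnq : (n : ℝ) / q = n - s := by rw [hq, hs]; field_simp; ring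
  rw [hnp, h2p, hnq, lintegral_sq_multilinear_riesz hn hα hg.ennreal_ofReal]
  have hG : 0 ≤ ∏ k, π ^ ((n : ℝ) / 2) * rieszConst n (α k) :=
    Finset.prod_nonneg fun k _ =>
      mul_nonneg (by positivity) (rieszConst_nonneg (hα k).1 (hα k).2)
  refine (mul_le_mul_right (rieszEnergy_le_gamma (s := s) hn (by linarith) (by linarith)
    hg.ennreal_ofReal fun x => ENNReal.ofReal_ne_top) _).trans (le_of_eq ?_)
  rw [← mul_assoc, ← ENNReal.ofReal_mul hG, ← hps]
  congr 2
  rw [Finset.prod_mul_distrib, Finset.prod_const, Finset.card_univ, Fintype.card_fin,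
    ← Real.rpow_natCast, ← Real.rpow_mul Real.pi_pos.le, Real.rpow_add Real.pi_pos,
    mul_comm ((n : ℝ) / 2), mul_div_assoc]
  simp only [rieszConst]
  clear_value s
  ring_nf
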